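/- arXiv:1709.09626 — 3 statements merged into one kernel-verified Lean document; each statement's English description precedes it below -/
import Mathlib

section
/- Let m, n ≥ 1. Every embedding f : M → N between existentially closed K_{m,n}-free incidence structures is an elementary embedding (in the language {P, L, I}). -/
open FirstOrder FirstOrder.Language

universe u v

/-- Relation symbols of the language of incidence structures: two unary symbols
(`pt` for "point", `lin` for "line") and one binary symbol (`inc` for "incidence"). -/
inductive IncRel : ℕ → Type
  | pt : IncRel 1
  | lin : IncRel 1
  | inc : IncRel 2

/-- The first-order language `{P, L, I}` of incidence structures. -/
def IncLang : FirstOrder.Language := ⟨fun _ => Empty, IncRel⟩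

section
variable {M : Type u} [IncLang.Structure M]

/-- `x` is a point. -/
def ptL (x : M) : Prop := Structure.RelMap (L := IncLang) IncRel.pt ![x]

/-- `x` is a line. -/
def lnL (x : M) : Prop := Structure.RelMap (L := IncLang) IncRel.lin ![x]

/-- `x` is incident to `y`. -/
def incL (x y : M) : Prop := Structure.RelMap (L := IncLang) IncRel.inc ![x, y]

end

/-- `M` is an incidence structure: points and lines partition the domain, and
incidence only holds between a point and a line. -/
def IsIncidenceL (M : Type u) [IncLang.Structure M] : Prop :=
  (∀ x : M, ptL x ∨ lnL x) ∧ (∀ x : M, ¬(ptL x ∧ lnL x)) ∧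
    ∀ x y : M, incL x y → ptL x ∧ lnL y

/-- `M` is `K_{m,n}`-free: there are no `m` pairwise distinct points and `n` pairwise
distinct lines with every one of the points incident to every one of the lines. -/
def KFreeL (m n : ℕ) (M : Type u) [IncLang.Structure M] : Prop :=
  ¬∃ (a : Fin m → M) (b : Fin n → M),
      Function.Injective a ∧ Function.Injective b ∧
      (∀ i, ptL (a i)) ∧ (∀ j, lnL (b j)) ∧ ∀ i j, incL (a i) (b j)

/-- `M` is an existentially closed `K_{m,n}`-free incidence structure: `M` is a
`K_{m,n}`-free incidence structure, and for every `K_{m,n}`-free incidence structure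
`N` containing `M` as an induced substructure (i.e. admitting an embedding of `M`),
every existential formula `∃ ȳ φ(ā, ȳ)` (with `φ` quantifier-free and parameters `ā`
from `M`) that holds in `N` also holds in `M`. -/
def IsECL (m n : ℕ) (M : Type u) [IncLang.Structure M] : Prop :=
  IsIncidenceL M ∧ KFreeL m n M ∧
    ∀ (N : Type u) [IncLang.Structure N], IsIncidenceL N → KFreeL m n N →
      ∀ (f : M ↪[IncLang] N) (k : ℕ) (φ : IncLang.BoundedFormula M k), φ.IsQF →
        (∃ xs : Fin k → N, φ.Realize (f : M → N) xs) →
          ∃ xs : Fin k → M, φ.Realize (id : M → M) xs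


section Proof

open Filter

theorem emb_rel1 {M N : Type u} [IncLang.Structure M] [IncLang.Structure N]
    (f : M ↪[IncLang] N) (r : IncLang.Relations 1) (x : M) :
    Structure.RelMap r ![f x] ↔ Structure.RelMap r ![x] := by
  rw [← f.map_rel]
  exact iff_of_eq (congrArg _ (funext fun i => by fin_cases i; rfl))

theorem emb_pt {M N : Type u} [IncLang.Structure M] [IncLang.Structure N] (f : M ↪[IncLang] N)
    (x : M) : ptL (f x) ↔ ptL x := emb_rel1 f IncRel.pt x

theorem emb_ln {M N : Type u} [IncLang.Structure M] [IncLang.Structure N] (f : M ↪[IncLang] N)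
    (x : M) : lnL (f x) ↔ lnL x := emb_rel1 f IncRel.lin x

theorem emb_rel2 {M N : Type u} [IncLang.Structure M] [IncLang.Structure N]
    (f : M ↪[IncLang] N) (r : IncLang.Relations 2) (x y : M) :
    Structure.RelMap r ![f x, f y] ↔ Structure.RelMap r ![x, y] := by
  rw [← f.map_rel]
  exact iff_of_eq (congrArg _ (funext fun i => by fin_cases i <;> rfl))

theorem emb_inc {M N : Type u} [IncLang.Structure M] [IncLang.Structure N] (f : M ↪[IncLang] N)
    (x y : M) : incL (f x) (f y) ↔ incL x y := emb_rel2 f IncRel.inc x y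

/-- Build an embedding from the basic relations. -/
def mkEmb {M N : Type u} [IncLang.Structure M] [IncLang.Structure N] (f : M → N)
    (hinj : Function.Injective f) (hp : ∀ x, ptL (f x) ↔ ptL x) (hl : ∀ x, lnL (f x) ↔ lnL x)
    (hi : ∀ x y, incL (f x) (f y) ↔ incL x y) : M ↪[IncLang] N where
  toFun := f
  inj' := hinj
  map_fun' := fun g _ => g.elim
  map_rel' := by
    intro k r x
    cases r with
    | pt =>
      have h := hp (x 0)
      unfold ptL at h
      have e1 : f ∘ x = ![f (x 0)] := funext fun i => by fin_cases i; rfl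
      have e2 : x = ![x 0] := funext fun i => by fin_cases i; rfl
      rw [← e1, ← e2] at h
      exact h
    | lin =>
      have h := hl (x 0)
      unfold lnL at h
      have e1 : f ∘ x = ![f (x 0)] := funext fun i => by fin_cases i; rfl
      have e2 : x = ![x 0] := funext fun i => by fin_cases i; rfl
      rw [← e1, ← e2] at h
      exact h
    | inc =>
      have h := hi (x 0) (x 1)
      unfold incL at h
      have e1 : f ∘ x = ![f (x 0), f (x 1)] := funext fun i => by fin_cases i <;> rfl
      have e2 : x = ![x 0, x 1] := funext fun i => by fin_cases i <;> rfl
      rw [← e1, ← e2] at h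
      exact h

/-- The local version of existential closedness. -/
def LocEC (m n : ℕ) (M : Type u) [IncLang.Structure M] : Prop :=
  IsIncidenceL M ∧ KFreeL m n M ∧
    ∀ (N : Type u) [IncLang.Structure N], IsIncidenceL N → KFreeL m n N →
      ∀ (f : M ↪[IncLang] N) (S : Set N), S.Finite →
        ∃ h : N → M, (∀ a, f a ∈ S → h (f a) = a) ∧
          ∀ x ∈ S, ∀ y ∈ S, (h x = h y ↔ x = y) ∧ (ptL (h x) ↔ ptL x) ∧
            (lnL (h x) ↔ lnL x) ∧ (incL (h x) (h y) ↔ incL x y)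

theorem finite_conj {M N : Type u} [IncLang.Structure M] [IncLang.Structure N]
    (f : M → N) {k : ℕ} (xs : Fin k → N) (F : Set (IncLang.BoundedFormula M k)) (hF : F.Finite)
    (hQ : ∀ φ ∈ F, φ.IsQF) :
    ∃ ψ : IncLang.BoundedFormula M k, ψ.IsQF ∧ ψ.Realize f xs ∧
      ∀ ys : Fin k → M, ψ.Realize id ys →
        ∀ φ ∈ F, (φ.Realize id ys ↔ φ.Realize f xs) := by
  induction F, hF using Set.Finite.induction_on with
  | empty => exact ⟨⊤, BoundedFormula.IsQF.top, by simp, by simp⟩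
  | @insert φ F _ _ ih =>
    obtain ⟨ψ, h1, h2, h3⟩ := ih fun φ h => hQ φ (Set.mem_insert_of_mem _ h)
    have hφ := hQ φ (Set.mem_insert _ _)
    by_cases hr : φ.Realize f xs
    · refine ⟨ψ ⊓ φ, h1.inf hφ, by simp [h2, hr], fun ys hy => ?_⟩
      rw [BoundedFormula.realize_inf] at hy
      rintro χ (rfl | h)
      · simp [hr, hy.2]
      · exact h3 ys hy.1 χ h
    · refine ⟨ψ ⊓ φ.not, h1.inf hφ.not, by simp [h2, hr], fun ys hy => ?_⟩
      rw [BoundedFormula.realize_inf, BoundedFormula.realize_not] at hy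
      rintro χ (rfl | h)
      · simp [hr, hy.2]
      · exact h3 ys hy.1 χ h

theorem IsECL.locEC {m n : ℕ} {M : Type u} [IncLang.Structure M] (hM : IsECL m n M) :
    LocEC m n M := by
  classical
  refine ⟨hM.1, hM.2.1, ?_⟩
  intro N _ hN hK f S hS
  rcases isEmpty_or_nonempty N with hE | ⟨⟨c0⟩⟩
  · exact ⟨fun x => hE.elim x, fun a => hE.elim (f a), fun x => hE.elim x⟩
  obtain ⟨k, xs, hxs⟩ : ∃ (k : ℕ) (xs : Fin k → N), Set.range xs = insert c0 S := by
    have := (hS.insert c0).fin_param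
    obtain ⟨k, xs, _, h⟩ := this
    exact ⟨k, xs, h⟩
  have hA : (f ⁻¹' (insert c0 S)).Finite :=
    (hS.insert c0).preimage (f.injective.injOn)
  let V : Fin k → IncLang.Term (M ⊕ Fin k) := fun i => Term.var (Sum.inr i)
  let C : M → IncLang.Term (M ⊕ Fin k) := fun a => Term.var (Sum.inl a)
  let PT : IncLang.Relations 1 := IncRel.pt
  let LN : IncLang.Relations 1 := IncRel.lin
  let IC : IncLang.Relations 2 := IncRel.inc
  let F : Set (IncLang.BoundedFormula M k) :=
    Set.range (fun p : Fin k × Fin k => (V p.1).bdEqual (V p.2)) ∪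
    (Set.range (fun p : Fin k => PT.boundedFormula₁ (V p)) ∪
    (Set.range (fun p : Fin k => LN.boundedFormula₁ (V p)) ∪
    (Set.range (fun p : Fin k × Fin k => IC.boundedFormula₂ (V p.1) (V p.2)) ∪
    (fun p : Fin k × M => (V p.1).bdEqual (C p.2)) '' (Set.univ ×ˢ (f ⁻¹' (insert c0 S))))))
  have hF : F.Finite :=
    (Set.finite_range _).union ((Set.finite_range _).union ((Set.finite_range _).union
      ((Set.finite_range _).union ((Set.finite_univ.prod hA).image _))))
  have hQ : ∀ φ ∈ F, φ.IsQF := by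
    rintro φ (⟨p, rfl⟩ | ⟨p, rfl⟩ | ⟨p, rfl⟩ | ⟨p, rfl⟩ | ⟨p, _, rfl⟩)
    · exact (BoundedFormula.IsAtomic.equal _ _).isQF
    · exact (BoundedFormula.IsAtomic.rel _ _).isQF
    · exact (BoundedFormula.IsAtomic.rel _ _).isQF
    · exact (BoundedFormula.IsAtomic.rel _ _).isQF
    · exact (BoundedFormula.IsAtomic.equal _ _).isQF
  obtain ⟨ψ, h1, h2, h3⟩ := finite_conj (f : M → N) xs F hF hQ
  obtain ⟨ys, hys⟩ := hM.2.2 N hN hK f k ψ h1 ⟨xs, h2⟩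
  have h4 := h3 ys hys
  have hEq : ∀ i j, ys i = ys j ↔ xs i = xs j := fun i j => by
    have := h4 _ (Or.inl ⟨(i, j), rfl⟩)
    simpa [V] using this
  have hPt : ∀ i, ptL (ys i) ↔ ptL (xs i) := fun i => by
    have := h4 _ (Or.inr (Or.inl ⟨i, rfl⟩))
    simp only [BoundedFormula.realize_rel₁, BoundedFormula.realize_rel₂] at this
    exact this
  have hLn : ∀ i, lnL (ys i) ↔ lnL (xs i) := fun i => by
    have := h4 _ (Or.inr (Or.inr (Or.inl ⟨i, rfl⟩)))
    simp only [BoundedFormula.realize_rel₁, BoundedFormula.realize_rel₂] at this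
    exact this
  have hIc : ∀ i j, incL (ys i) (ys j) ↔ incL (xs i) (xs j) := fun i j => by
    have := h4 _ (Or.inr (Or.inr (Or.inr (Or.inl ⟨(i, j), rfl⟩))))
    simp only [BoundedFormula.realize_rel₁, BoundedFormula.realize_rel₂] at this
    exact this
  have hCo : ∀ i a, f a ∈ insert c0 S → (ys i = a ↔ xs i = f a) := fun i a ha => by
    have := h4 _ (Or.inr (Or.inr (Or.inr (Or.inr ⟨(i, a), ⟨Set.mem_univ _, ha⟩, rfl⟩))))
    simpa [V, C] using this
  obtain ⟨i0, -⟩ : c0 ∈ Set.range xs := by rw [hxs]; exact Set.mem_insert _ _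
  have hx : ∀ x, ∃ i, x ∈ S → xs i = x := fun x => by
    by_cases h : x ∈ S
    · obtain ⟨i, hi⟩ : x ∈ Set.range xs := by rw [hxs]; exact Set.mem_insert_of_mem _ h
      exact ⟨i, fun _ => hi⟩
    · exact ⟨i0, fun h' => absurd h' h⟩
  choose g hg using hx
  refine ⟨fun x => ys (g x), ?_, ?_⟩
  · intro a ha
    exact (hCo _ _ (Set.mem_insert_of_mem _ ha)).2 (hg _ ha)
  · intro x hx y hy
    simp only [hEq, hPt, hLn, hIc, hg x hx, hg y hy, and_self]

/-- Ultrapower. -/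
abbrev UPow {I : Type u} (U : Ultrafilter I) (M : Type u) : Type u :=
  (U : Filter I).Product (fun _ : I => M)

/-- Class of a sequence. -/
def upMk {I : Type u} (U : Ultrafilter I) {M : Type u} (x : I → M) : UPow U M :=
  Quotient.mk ((U : Filter I).productSetoid fun _ : I => M) x

theorem upMk_surj {I : Type u} (U : Ultrafilter I) {M : Type u} (b : UPow U M) :
    ∃ x, upMk U x = b := Quotient.exists_rep b

theorem upMk_eq {I : Type u} (U : Ultrafilter I) {M : Type u} (x y : I → M) :
    upMk U x = upMk U y ↔ ∀ᶠ t in U, x t = y t := Quotient.eq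

/-- A chosen representative. -/
noncomputable def upRep {I : Type u} {U : Ultrafilter I} {M : Type u} (b : UPow U M) : I → M :=
  Classical.choose (upMk_surj U b)

theorem upMk_rep {I : Type u} {U : Ultrafilter I} {M : Type u} (b : UPow U M) :
    upMk U (upRep b) = b := Classical.choose_spec (upMk_surj U b)

theorem upRep_mk {I : Type u} {U : Ultrafilter I} {M : Type u} (x : I → M) :
    ∀ᶠ t in U, x t = upRep (upMk U x) t := (upMk_eq U _ _).1 (upMk_rep _).symm

theorem up_pigeon {I : Type u} (U : Ultrafilter I) {ι : Type u} {A : Set ι} (hA : A.Finite)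
    {p : ι → I → Prop} (h : ∀ᶠ t in U, ∃ i ∈ A, p i t) : ∃ i ∈ A, ∀ᶠ t in U, p i t := by
  have := (Ultrafilter.finite_biUnion_mem_iff (f := U) (s := fun i => {t | p i t}) hA).1 (by
    filter_upwards [h] with t ht
    simpa using ht)
  exact this

section UP
variable {I : Type u} (U : Ultrafilter I) {M : Type u} [IncLang.Structure M]

theorem upMk_rel {k : ℕ} (r : IncLang.Relations k) (x : Fin k → I → M) :
    Structure.RelMap r (fun i => upMk U (x i)) ↔ ∀ᶠ t in U, Structure.RelMap r fun i => x i t := by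
  exact relMap_quotient_mk' ((U : Filter I).productSetoid fun _ : I => M) r x

theorem upMk_rel1 (r : IncLang.Relations 1) (x : I → M) :
    Structure.RelMap r ![upMk U x] ↔ ∀ᶠ t in U, Structure.RelMap r ![x t] := by
  have h := upMk_rel U (M := M) r ![x]
  have e1 : (fun i => upMk U ((![x] : Fin 1 → I → M) i)) = ![upMk U x] := by
    funext i; fin_cases i; rfl
  have e2 : ∀ t, (fun i => (![x] : Fin 1 → I → M) i t) = ![x t] := by
    intro t; funext i; fin_cases i; rfl
  simpa only [e1, e2] using h

theorem upMk_rel2 (r : IncLang.Relations 2) (x y : I → M) :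
    Structure.RelMap r ![upMk U x, upMk U y] ↔ ∀ᶠ t in U, Structure.RelMap r ![x t, y t] := by
  have h := upMk_rel U (M := M) r ![x, y]
  have e1 : (fun i => upMk U ((![x, y] : Fin 2 → I → M) i)) = ![upMk U x, upMk U y] := by
    funext i; fin_cases i <;> rfl
  have e2 : ∀ t, (fun i => (![x, y] : Fin 2 → I → M) i t) = ![x t, y t] := by
    intro t; funext i; fin_cases i <;> rfl
  simpa only [e1, e2] using h

theorem upMk_pt (x : I → M) : ptL (upMk U x) ↔ ∀ᶠ t in U, ptL (x t) := upMk_rel1 U IncRel.pt x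

theorem upMk_ln (x : I → M) : lnL (upMk U x) ↔ ∀ᶠ t in U, lnL (x t) := upMk_rel1 U IncRel.lin x

theorem upMk_inc (x y : I → M) : incL (upMk U x) (upMk U y) ↔ ∀ᶠ t in U, incL (x t) (y t) :=
  upMk_rel2 U IncRel.inc x y

theorem upRep_pt {U : Ultrafilter I} (b : UPow U M) : ptL b ↔ ∀ᶠ t in U, ptL (upRep b t) := by
  rw [← upMk_pt, upMk_rep]

theorem upRep_ln {U : Ultrafilter I} (b : UPow U M) : lnL b ↔ ∀ᶠ t in U, lnL (upRep b t) := by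
  rw [← upMk_ln, upMk_rep]

theorem upRep_inc {U : Ultrafilter I} (b c : UPow U M) :
    incL b c ↔ ∀ᶠ t in U, incL (upRep b t) (upRep c t) := by
  rw [← upMk_inc, upMk_rep, upMk_rep]

theorem upRep_eq {U : Ultrafilter I} (b c : UPow U M) :
    b = c ↔ ∀ᶠ t in U, upRep b t = upRep c t := by
  rw [← upMk_eq, upMk_rep, upMk_rep]

theorem upow_incidence (h : IsIncidenceL M) : IsIncidenceL (UPow U M) := by
  refine ⟨fun x => ?_, fun x => ?_, fun x y => ?_⟩
  · rw [upRep_pt, upRep_ln, ← Ultrafilter.eventually_or]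
    exact Eventually.of_forall fun t => h.1 _
  · rw [upRep_pt, upRep_ln]
    rintro ⟨h1, h2⟩
    obtain ⟨t, ht⟩ := (h1.and h2).exists
    exact h.2.1 _ ht
  · rw [upRep_pt, upRep_ln, upRep_inc]
    intro hh
    exact ⟨hh.mono fun t ht => (h.2.2 _ _ ht).1, hh.mono fun t ht => (h.2.2 _ _ ht).2⟩

theorem upow_kfree {m n : ℕ} (h : KFreeL m n M) : KFreeL m n (UPow U M) := by
  rintro ⟨a, b, ha, hb, hp, hl, hi⟩
  have h1 : ∀ᶠ t in U, ∀ i j, i ≠ j → upRep (a i) t ≠ upRep (a j) t :=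
    eventually_all.2 fun i => eventually_all.2 fun j => by
      by_cases hij : i = j
      · simp [hij]
      · have := mt (upRep_eq (a i) (a j)).2 (ha.ne hij)
        exact (Ultrafilter.eventually_not.2 this).mono fun t ht _ => ht
  have h2 : ∀ᶠ t in U, ∀ i j, i ≠ j → upRep (b i) t ≠ upRep (b j) t :=
    eventually_all.2 fun i => eventually_all.2 fun j => by
      by_cases hij : i = j
      · simp [hij]
      · have := mt (upRep_eq (b i) (b j)).2 (hb.ne hij)
        exact (Ultrafilter.eventually_not.2 this).mono fun t ht _ => ht
  have h3 : ∀ᶠ t in U, ∀ i, ptL (upRep (a i) t) := eventually_all.2 fun i => (upRep_pt _).1 (hp i)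
  have h4 : ∀ᶠ t in U, ∀ i, lnL (upRep (b i) t) := eventually_all.2 fun i => (upRep_ln _).1 (hl i)
  have h5 : ∀ᶠ t in U, ∀ i j, incL (upRep (a i) t) (upRep (b j) t) :=
    eventually_all.2 fun i => eventually_all.2 fun j => (upRep_inc _ _).1 (hi i j)
  obtain ⟨t, h1, h2, h3, h4, h5⟩ := (h1.and (h2.and (h3.and (h4.and h5)))).exists
  refine h ⟨fun i => upRep (a i) t, fun i => upRep (b i) t, ?_, ?_, h3, h4, h5⟩
  · intro i j hij
    by_contra hne
    exact h1 i j hne hij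
  · intro i j hij
    by_contra hne
    exact h2 i j hne hij

end UP

/-- Structure from relations. -/
def mkStr {X : Type u} (P L : X → Prop) (J : X → X → Prop) : IncLang.Structure X where
  funMap := fun f => f.elim
  RelMap := fun r => match r with
    | IncRel.pt => fun v => P (v 0)
    | IncRel.lin => fun v => L (v 0)
    | IncRel.inc => fun v => J (v 0) (v 1)

section Ext
variable {I : Type u} {U : Ultrafilter I} {M N : Type u} [IncLang.Structure M]
  [IncLang.Structure N] (F : UPow U M ↪[IncLang] N) (S : Set N)

/-- New elements. -/
abbrev NewT : Type u := {s : N // s ∈ S ∧ s ∉ Set.range F}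

/-- Points of the extension. -/
def extP : M ⊕ NewT F S → Prop
  | Sum.inl x => ptL x
  | Sum.inr s => ptL s.1

/-- Lines of the extension. -/
def extL : M ⊕ NewT F S → Prop
  | Sum.inl x => lnL x
  | Sum.inr s => lnL s.1

/-- Incidence of the extension. -/
def extI (t : I) : M ⊕ NewT F S → M ⊕ NewT F S → Prop
  | Sum.inl x, Sum.inl y => incL x y
  | Sum.inr s, Sum.inr s' => incL s.1 s'.1
  | Sum.inl x, Sum.inr s => ptL x ∧ ∃ b, b ∈ F ⁻¹' S ∧ x = upRep b t ∧ incL (F b) s.1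
  | Sum.inr s, Sum.inl y => lnL y ∧ ∃ b, b ∈ F ⁻¹' S ∧ y = upRep b t ∧ incL s.1 (F b)

/-- The extension. -/
abbrev extStr (t : I) : IncLang.Structure (M ⊕ NewT F S) :=
  mkStr (extP F S) (extL F S) (extI F S t)

theorem ext_incidence (hM : IsIncidenceL M) (hN : IsIncidenceL N) (t : I) :
    @IsIncidenceL (M ⊕ NewT F S) (extStr F S t) := by
  refine ⟨?_, ?_, ?_⟩
  · rintro (x | s)
    · exact hM.1 x
    · exact hN.1 s.1
  · rintro (x | s)
    · exact hM.2.1 x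
    · exact hN.2.1 s.1
  · rintro (x | s) (y | s') h
    · exact hM.2.2 x y h
    · obtain ⟨h1, b, -, -, h2⟩ := h
      exact ⟨h1, (hN.2.2 _ _ h2).2⟩
    · obtain ⟨h1, b, -, -, h2⟩ := h
      exact ⟨(hN.2.2 _ _ h2).1, h1⟩
    · exact hN.2.2 s.1 s'.1 h

/-- A sequence of elements of the extensions represents an element. -/
def ReprE (e : I → M ⊕ NewT F S) (c : N) : Prop :=
  (∃ b, c = F b ∧ ∀ᶠ t in U, e t = Sum.inl (upRep b t)) ∨
    ∃ s : NewT F S, c = s.1 ∧ ∀ᶠ t in U, e t = Sum.inr s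

variable {F S}

theorem exists_reprE (hS : S.Finite) (e : I → M ⊕ NewT F S) : ∃ c, ReprE F S e c := by
  have : Finite (NewT F S) := (hS.subset fun s hs => hs.1 : {s | s ∈ S ∧ s ∉ Set.range F}.Finite)
  have h : ∀ᶠ t in U, (∃ x, e t = Sum.inl x) ∨ ∃ s, e t = Sum.inr s :=
    Eventually.of_forall fun t => by
      rcases e t with x | s
      · exact Or.inl ⟨x, rfl⟩
      · exact Or.inr ⟨s, rfl⟩
  rcases Ultrafilter.eventually_or.1 h with h | h
  · obtain ⟨x, hx⟩ := h.choice
    refine ⟨F (upMk U x), Or.inl ⟨_, rfl, ?_⟩⟩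
    filter_upwards [hx, upRep_mk (U := U) x] with t h1 h2
    rw [h1, h2]
  · obtain ⟨s, -, hs⟩ := up_pigeon U (A := (Set.univ : Set (NewT F S))) Set.finite_univ
      (p := fun s t => e t = Sum.inr s) (h.mono fun t ⟨s, hs⟩ => ⟨s, trivial, hs⟩)
    exact ⟨s.1, Or.inr ⟨s, rfl, hs⟩⟩

theorem reprE_pt {e : I → M ⊕ NewT F S} {c : N} (h : ReprE F S e c) :
    ptL c ↔ ∀ᶠ t in U, extP F S (e t) := by
  rcases h with ⟨b, rfl, h⟩ | ⟨s, rfl, h⟩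
  · rw [emb_pt, upRep_pt]
    exact eventually_congr (h.mono fun t ht => by rw [ht]; rfl)
  · rw [← eventually_const (f := (U : Filter I)) (p := ptL s.1)]
    exact eventually_congr (h.mono fun t ht => by rw [ht]; rfl)

theorem reprE_ln {e : I → M ⊕ NewT F S} {c : N} (h : ReprE F S e c) :
    lnL c ↔ ∀ᶠ t in U, extL F S (e t) := by
  rcases h with ⟨b, rfl, h⟩ | ⟨s, rfl, h⟩
  · rw [emb_ln, upRep_ln]
    exact eventually_congr (h.mono fun t ht => by rw [ht]; rfl)
  · rw [← eventually_const (f := (U : Filter I)) (p := lnL s.1)]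
    exact eventually_congr (h.mono fun t ht => by rw [ht]; rfl)

theorem reprE_eq {e e' : I → M ⊕ NewT F S} {c c' : N} (h : ReprE F S e c) (h' : ReprE F S e' c') :
    c = c' ↔ ∀ᶠ t in U, e t = e' t := by
  rcases h with ⟨b, rfl, h⟩ | ⟨s, rfl, h⟩ <;> rcases h' with ⟨b', rfl, h'⟩ | ⟨s', rfl, h'⟩
  · rw [EmbeddingLike.apply_eq_iff_eq, upRep_eq]
    refine eventually_congr ?_
    filter_upwards [h, h'] with t h1 h2
    rw [h1, h2, Sum.inl.injEq]
  · refine iff_of_false (fun hh => s'.2.2 ⟨b, hh⟩) fun hh => ?_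
    obtain ⟨t, h1, h2, h3⟩ := (hh.and (h.and h')).exists
    rw [h2, h3] at h1
    cases h1
  · refine iff_of_false (fun hh => s.2.2 ⟨b', hh.symm⟩) fun hh => ?_
    obtain ⟨t, h1, h2, h3⟩ := (hh.and (h.and h')).exists
    rw [h2, h3] at h1
    cases h1
  · rw [← eventually_const (f := (U : Filter I)) (p := s.1 = s'.1)]
    refine eventually_congr ?_
    filter_upwards [h, h'] with t h1 h2
    rw [h1, h2, Sum.inr.injEq, Subtype.ext_iff]

theorem reprE_inc (hS : S.Finite) {e e' : I → M ⊕ NewT F S} {c c' : N}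
    (h : ReprE F S e c) (h' : ReprE F S e' c') (hi : ∀ᶠ t in U, extI F S t (e t) (e' t)) :
    incL c c' := by
  have hA : (F ⁻¹' S).Finite := hS.preimage F.injective.injOn
  rcases h with ⟨b, rfl, h⟩ | ⟨s, rfl, h⟩ <;> rcases h' with ⟨b', rfl, h'⟩ | ⟨s', rfl, h'⟩
  · rw [emb_inc, upRep_inc]
    filter_upwards [h, h', hi] with t h1 h2 h3
    rw [h1, h2] at h3
    exact h3
  · obtain ⟨b', hb', hh⟩ := up_pigeon U hA
      (p := fun b' t => upRep b t = upRep b' t ∧ incL (F b') s'.1) (by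
        filter_upwards [h, h', hi] with t h1 h2 h3
        rw [h1, h2] at h3
        exact h3.2)
    rw [(upRep_eq b b').2 (hh.mono fun t ht => ht.1)]
    obtain ⟨t, ht⟩ := hh.exists
    exact ht.2
  · obtain ⟨b, hb, hh⟩ := up_pigeon U hA
      (p := fun b t => upRep b' t = upRep b t ∧ incL s.1 (F b)) (by
        filter_upwards [h, h', hi] with t h1 h2 h3
        rw [h1, h2] at h3
        exact h3.2)
    rw [(upRep_eq b' b).2 (hh.mono fun t ht => ht.1)]
    obtain ⟨t, ht⟩ := hh.exists
    exact ht.2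
  · obtain ⟨t, h1, h2, h3⟩ := (h.and (h'.and hi)).exists
    rw [h1, h2] at h3
    exact h3

theorem reprE_inc_rev (hN : IsIncidenceL N) {e e' : I → M ⊕ NewT F S} {c c' : N}
    (hc : c ∈ S) (hc' : c' ∈ S)
    (h : ReprE F S e c) (h' : ReprE F S e' c') (hi : incL c c') :
    ∀ᶠ t in U, extI F S t (e t) (e' t) := by
  have hp := (hN.2.2 _ _ hi).1
  have hl := (hN.2.2 _ _ hi).2
  rcases h with ⟨b, rfl, h⟩ | ⟨s, rfl, h⟩ <;> rcases h' with ⟨b', rfl, h'⟩ | ⟨s', rfl, h'⟩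
  · rw [emb_inc, upRep_inc] at hi
    filter_upwards [h, h', hi] with t h1 h2 h3
    rw [h1, h2]
    exact h3
  · rw [emb_pt, upRep_pt] at hp
    filter_upwards [h, h', hp] with t h1 h2 h3
    rw [h1, h2]
    exact ⟨h3, b, hc, rfl, hi⟩
  · rw [emb_ln, upRep_ln] at hl
    filter_upwards [h, h', hl] with t h1 h2 h3
    rw [h1, h2]
    exact ⟨h3, b', hc', rfl, hi⟩
  · filter_upwards [h, h'] with t h1 h2
    rw [h1, h2]
    exact hi

theorem ext_kfree (hS : S.Finite) {m n : ℕ} (hK : KFreeL m n N) :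
    ∀ᶠ t in U, @KFreeL m n (M ⊕ NewT F S) (extStr F S t) := by
  by_contra hcon
  rw [← Ultrafilter.eventually_not] at hcon
  have hcon : ∀ᶠ t in U, ∃ ab : (Fin m → M ⊕ NewT F S) × (Fin n → M ⊕ NewT F S),
      Function.Injective ab.1 ∧ Function.Injective ab.2 ∧
      (∀ i, extP F S (ab.1 i)) ∧ (∀ j, extL F S (ab.2 j)) ∧
        ∀ i j, extI F S t (ab.1 i) (ab.2 j) := by
    filter_upwards [hcon] with t ht
    obtain ⟨a, b, h⟩ := not_not.1 ht
    exact ⟨(a, b), h⟩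
  obtain ⟨ab, hab⟩ := hcon.choice
  choose a ha using fun i => exists_reprE (U := U) hS (fun t => (ab t).1 i)
  choose b hb using fun i => exists_reprE (U := U) hS (fun t => (ab t).2 i)
  refine hK ⟨a, b, ?_, ?_, ?_, ?_, ?_⟩
  · intro i j hij
    obtain ⟨t, h1, h2⟩ := (((reprE_eq (ha i) (ha j)).1 hij).and hab).exists
    exact h2.1 h1
  · intro i j hij
    obtain ⟨t, h1, h2⟩ := (((reprE_eq (hb i) (hb j)).1 hij).and hab).exists
    exact h2.2.1 h1
  · intro i
    exact (reprE_pt (ha i)).2 (hab.mono fun t ht => ht.2.2.1 i)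
  · intro i
    exact (reprE_ln (hb i)).2 (hab.mono fun t ht => ht.2.2.2.1 i)
  · intro i j
    exact reprE_inc hS (ha i) (hb j) (hab.mono fun t ht => ht.2.2.2.2 i j)

variable (F S)

/-- The base embeds in the extension. -/
def extEmb (t : I) : @FirstOrder.Language.Embedding IncLang M (M ⊕ NewT F S) _ (extStr F S t) :=
  letI := extStr F S t
  mkEmb Sum.inl Sum.inl_injective (fun _ => Iff.rfl) (fun _ => Iff.rfl) (fun _ _ => Iff.rfl)

theorem ext_apply {m n : ℕ} (hM : LocEC m n M) (hN : IsIncidenceL N) (hS : S.Finite) (t : I)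
    (hK : @KFreeL m n (M ⊕ NewT F S) (extStr F S t)) :
    ∃ h : M ⊕ NewT F S → M, (∀ b, F b ∈ S → h (Sum.inl (upRep b t)) = upRep b t) ∧
      ∀ x y, (x ∈ Set.range Sum.inr ∨ ∃ b, F b ∈ S ∧ x = Sum.inl (upRep b t)) →
        (y ∈ Set.range Sum.inr ∨ ∃ b, F b ∈ S ∧ y = Sum.inl (upRep b t)) →
        (h x = h y ↔ x = y) ∧ (ptL (h x) ↔ extP F S x) ∧
            (lnL (h x) ↔ extL F S x) ∧ (incL (h x) (h y) ↔ extI F S t x y) := by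
  have : Finite (NewT F S) := (hS.subset fun s hs => hs.1 : {s | s ∈ S ∧ s ∉ Set.range F}.Finite)
  have hA : (F ⁻¹' S).Finite := hS.preimage F.injective.injOn
  letI := extStr F S t
  obtain ⟨h, h1, h2⟩ := hM.2.2 (M ⊕ NewT F S) (ext_incidence F S hM.1 hN t) hK (extEmb F S t)
    (Set.range Sum.inr ∪ (fun b => Sum.inl (upRep b t)) '' (F ⁻¹' S))
    ((Set.finite_range _).union (hA.image _))
  refine ⟨h, fun b hb => h1 _ (Or.inr ⟨b, hb, rfl⟩), fun x y hx hy => h2 x ?_ y ?_⟩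
  · rcases hx with hx | ⟨b, hb, rfl⟩
    · exact Or.inl hx
    · exact Or.inr ⟨b, hb, rfl⟩
  · rcases hy with hx | ⟨b, hb, rfl⟩
    · exact Or.inl hx
    · exact Or.inr ⟨b, hb, rfl⟩

end Ext

theorem LocEC.upow {m n : ℕ} {M : Type u} [IncLang.Structure M] (hM : LocEC m n M)
    {I : Type u} (U : Ultrafilter I) : LocEC m n (UPow U M) := by
  classical
  refine ⟨upow_incidence U hM.1, upow_kfree U hM.2.1, ?_⟩
  intro N _ hN hK F S' hS'
  rcases isEmpty_or_nonempty N with hE | ⟨⟨c0⟩⟩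
  · exact ⟨fun x => hE.elim x, fun a => hE.elim (F a), fun x => hE.elim x⟩
  obtain ⟨S, hS, hSS, hc0⟩ : ∃ S : Set N, S.Finite ∧ S' ⊆ S ∧ c0 ∈ S :=
    ⟨insert c0 S', hS'.insert c0, Set.subset_insert _ _, Set.mem_insert _ _⟩
  suffices H : ∃ h : N → UPow U M, (∀ a, F a ∈ S → h (F a) = a) ∧
      ∀ x ∈ S, ∀ y ∈ S, (h x = h y ↔ x = y) ∧ (ptL (h x) ↔ ptL x) ∧
        (lnL (h x) ↔ lnL x) ∧ (incL (h x) (h y) ↔ incL x y) by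
    obtain ⟨h, h1, h2⟩ := H
    exact ⟨h, fun a ha => h1 a (hSS ha), fun x hx y hy => h2 x (hSS hx) y (hSS hy)⟩
  obtain ⟨h, hh⟩ := ((ext_kfree (F := F) hS hK).mono fun t ht =>
    ext_apply F S hM hN hS t ht).choice
  have hrep : ∀ c ∈ S, ∃ e : I → M ⊕ NewT F S, (ReprE F S e c ∧
      ((∃ b, c = F b ∧ e = fun t => Sum.inl (upRep b t)) ∨ ∃ s, e = fun _ => Sum.inr s)) := by
    intro c hc
    by_cases hb : ∃ b, F b = c
    · obtain ⟨b, rfl⟩ := hb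
      exact ⟨fun t => Sum.inl (upRep b t), Or.inl ⟨b, rfl, by simp⟩, Or.inl ⟨b, rfl, rfl⟩⟩
    · exact ⟨fun t => Sum.inr ⟨c, hc, hb⟩, Or.inr ⟨⟨c, hc, hb⟩, rfl, by simp⟩,
        Or.inr ⟨_, rfl⟩⟩
  have hne : Nonempty (I → M ⊕ NewT F S) := ⟨(hrep c0 hc0).choose⟩
  choose! e he using hrep
  have hmem : ∀ c ∈ S, ∀ t,
      (e c t ∈ Set.range Sum.inr ∨ ∃ b, F b ∈ S ∧ e c t = Sum.inl (upRep b t)) := by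
    intro c hc t
    rcases (he c hc).2 with ⟨b, rfl, h⟩ | ⟨s, h⟩
    · rw [h]
      exact Or.inr ⟨b, hc, rfl⟩
    · rw [h]
      exact Or.inl ⟨s, rfl⟩
  refine ⟨fun c => upMk U fun t => h t (e c t), ?_, ?_⟩
  · intro b hb
    conv_rhs => rw [← upMk_rep b]
    rw [upMk_eq]
    rcases (he _ hb).1 with ⟨b', h1, h2⟩ | ⟨s, h1, h2⟩
    · obtain rfl := F.injective h1
      filter_upwards [h2, hh] with t h3 h4
      rw [h3]
      exact h4.1 b hb
    · exact absurd ⟨b, h1⟩ s.2.2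
  · intro x hx y hy
    refine ⟨?_, ?_, ?_, ?_⟩
    · rw [upMk_eq, reprE_eq (he x hx).1 (he y hy).1]
      exact eventually_congr (hh.mono fun t ht => (ht.2 _ _ (hmem x hx t) (hmem y hy t)).1)
    · rw [upMk_pt, reprE_pt (he x hx).1]
      exact eventually_congr (hh.mono fun t ht => (ht.2 _ _ (hmem x hx t) (hmem y hy t)).2.1)
    · rw [upMk_ln, reprE_ln (he x hx).1]
      exact eventually_congr (hh.mono fun t ht => (ht.2 _ _ (hmem x hx t) (hmem y hy t)).2.2.1)
    · rw [upMk_inc]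
      refine (eventually_congr
        (hh.mono fun t ht => (ht.2 _ _ (hmem x hx t) (hmem y hy t)).2.2.2)).trans ?_
      exact ⟨reprE_inc hS (he x hx).1 (he y hy).1,
        reprE_inc_rev hN hx hy (he x hx).1 (he y hy).1⟩

theorem LocEC.exists_up {m n : ℕ} {M N : Type u} [IncLang.Structure M] [IncLang.Structure N]
    (hM : LocEC m n M) (hN : LocEC m n N) (f : M ↪[IncLang] N) :
    ∃ (I : Type u) (U : Ultrafilter I) (g : N ↪[IncLang] UPow U M),
      ∀ a, g (f a) = upMk U (fun _ => a) := by
  classical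
  choose h h1 h2 using fun S : Finset N => hM.2.2 N hN.1 hN.2.1 f (S : Set N) S.finite_toSet
  let U : Ultrafilter (Finset N) := Ultrafilter.of atTop
  have hU : ∀ c : N, ∀ᶠ S in (U : Filter (Finset N)), c ∈ S := fun c =>
    Ultrafilter.of_le (f := (atTop : Filter (Finset N))) <| by
      filter_upwards [eventually_ge_atTop ({c} : Finset N)] with S hS
      exact hS (by simp)
  refine ⟨Finset N, U, mkEmb (fun c => upMk U fun S => h S c) ?_ ?_ ?_ ?_, ?_⟩
  · intro x y hxy
    have := (upMk_eq U _ _).1 hxy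
    obtain ⟨S, hS, hx, hy⟩ := (this.and ((hU x).and (hU y))).exists
    exact (h2 S x hx y hy).1.1 hS
  · intro x
    rw [upMk_pt, ← eventually_const (f := (U : Filter (Finset N))) (p := ptL x)]
    apply eventually_congr
    filter_upwards [hU x] with S hS
    exact (h2 S x hS x hS).2.1
  · intro x
    rw [upMk_ln, ← eventually_const (f := (U : Filter (Finset N))) (p := lnL x)]
    apply eventually_congr
    filter_upwards [hU x] with S hS
    exact (h2 S x hS x hS).2.2.1
  · intro x y
    rw [upMk_inc, ← eventually_const (f := (U : Filter (Finset N))) (p := incL x y)]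
    apply eventually_congr
    filter_upwards [hU x, hU y] with S hS hS'
    exact (h2 S x hS y hS').2.2.2
  · intro a
    change upMk U (fun S => h S (f a)) = _
    rw [upMk_eq]
    filter_upwards [hU (f a)] with S hS
    exact h1 S a hS

theorem locEC_elementary (m n : ℕ) {α : Type} {l : ℕ} (φ : IncLang.BoundedFormula α l) :
    ∀ (M N : Type u) [IncLang.Structure M] [IncLang.Structure N], LocEC m n M → LocEC m n N →
      ∀ (f : M ↪[IncLang] N) (v : α → M) (xs : Fin l → M),
      φ.Realize (f ∘ v) (f ∘ xs) ↔ φ.Realize v xs := by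
  induction φ with
  | falsum => intros; exact Iff.rfl
  | equal =>
    intro M N _ _ _ _ f v xs
    simp only [BoundedFormula.Realize, ← Sum.comp_elim, HomClass.realize_term,
      EmbeddingLike.apply_eq_iff_eq f]
  | rel =>
    intro M N _ _ _ _ f v xs
    simp only [BoundedFormula.Realize, ← Sum.comp_elim, HomClass.realize_term]
    exact StrongHomClass.map_rel f _ _
  | imp _ _ ih1 ih2 =>
    intro M N _ _ hM hN f v xs
    simp only [BoundedFormula.Realize, ih1 M N hM hN, ih2 M N hM hN]
  | all φ ih =>
    intro M N _ _ hM hN f v xs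
    constructor
    · intro h a
      rw [← ih M N hM hN f, Fin.comp_snoc]
      exact h (f a)
    · intro h c
      obtain ⟨I, U, g, hg⟩ := hM.exists_up hN f
      obtain ⟨h0, -⟩ := hM.2.2 N hN.1 hN.2.1 f ∅ Set.finite_empty
      have : Nonempty M := ⟨h0 c⟩
      have key : φ.all.Realize (fun i => upMk U fun _ => v i) (fun i => upMk U fun _ => xs i) :=
        (Ultraproduct.boundedFormula_realize_cast (u := U) (M := fun _ : I => M) φ.all
          (fun i _ => v i) (fun i _ => xs i)).2 (Eventually.of_forall fun _ => h)
      have e1 : (g ∘ f ∘ v) = fun i => upMk U fun _ => v i := funext fun i => hg _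
      have e2 : (g ∘ f ∘ xs) = fun i => upMk U fun _ => xs i := funext fun i => hg _
      rw [← ih N (UPow U M) hN (hM.upow U) g, Fin.comp_snoc, e1, e2]
      exact key (g c)

end Proof

/-- Every embedding between existentially closed `K_{m,n}`-free incidence structures
is elementary. -/
theorem statement_3 (m n : ℕ) (hm : 1 ≤ m) (hn : 1 ≤ n)
    {M N : Type u} [IncLang.Structure M] [IncLang.Structure N]
    (hM : IsECL m n M) (hN : IsECL m n N) (f : M ↪[IncLang] N) :
    ∀ (k : ℕ) (φ : IncLang.Formula (Fin k)) (v : Fin k → M),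
      φ.Realize ((f : M → N) ∘ v) ↔ φ.Realize v := by
  intro k φ v
  have h := locEC_elementary m n φ M N hM.locEC hN.locEC f v default
  unfold Formula.Realize
  rw [← h]
  exact iff_of_eq (congrArg _ (Subsingleton.elim _ _))
end

section
/- Let m, n ≥ 1. For every first-order formula φ(x_1,…,x_k) in the language {P, L, I}, there exist finitely many basic existential formulas ψ_1(x_1,…,x_k),…,ψ_r(x_1,…,x_k) such that for every existentially closed K_{m,n}-free incidence structure M and every k-tuple ā from M, M ⊨ φ(ā) if and only if M ⊨ ψ_i(ā) for some i ≤ r. -/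
open FirstOrder FirstOrder.Language

universe u v

/-- A subset `Y` of an incidence structure is `I`-closed: whenever `m` pairwise
distinct points of `Y` are all incident to an element `y`, then `y ∈ Y`, and dually. -/
def IClosedL (m n : ℕ) {M : Type u} [IncLang.Structure M] (Y : Set M) : Prop :=
  (∀ (a : Fin m → M) (y : M), Function.Injective a → (∀ i, ptL (a i)) →
    (∀ i, a i ∈ Y) → (∀ i, incL (a i) y) → y ∈ Y) ∧
  (∀ (b : Fin n → M) (x : M), Function.Injective b → (∀ j, lnL (b j)) →
    (∀ j, b j ∈ Y) → (∀ j, incL x (b j)) → x ∈ Y)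

/-- The `I`-closure of `A`: the smallest `I`-closed subset containing `A`. -/
def iclL (m n : ℕ) {M : Type u} [IncLang.Structure M] (A : Set M) : Set M :=
  ⋂₀ {Y : Set M | IClosedL m n Y ∧ A ⊆ Y}

/-- The tuple `u` in `M` realizes exactly the same complete quantifier-free type
(equalities, point/line predicates, and incidences) as the tuple `w` in `A`. -/
def SameQFPattern {A : Type} [IncLang.Structure A] {M : Type u} [IncLang.Structure M]
    {ι : Type} (w : ι → A) (u : ι → M) : Prop :=
  (∀ i j, u i = u j ↔ w i = w j) ∧ (∀ i, ptL (u i) ↔ ptL (w i)) ∧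
    (∀ i, lnL (u i) ↔ lnL (w i)) ∧ ∀ i j, incL (u i) (u j) ↔ incL (w i) (w j)

/-- `ψ(x₁, …, x_k)` is a basic existential formula: a formula `∃ ȳ Δ(x̄, ȳ)` where `Δ`
is the conjunction of a complete quantifier-free type in the variables `x̄ȳ` realized
in some `K_{m,n}`-free incidence structure (here `A`, via the labeling `w`, with `w`
surjective) in which the elements labeled by `x̄` generate the elements labeled by
`x̄ȳ` under `I`-closure. -/
def IsBasicExistential (m n k : ℕ) (ψ : IncLang.Formula (Fin k)) : Prop :=
  ∃ (b : ℕ) (A : Type) (_ : IncLang.Structure A) (w : Fin k ⊕ Fin b → A),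
    IsIncidenceL A ∧ KFreeL m n A ∧ Function.Surjective w ∧
    iclL m n (Set.range (w ∘ Sum.inl)) = Set.univ ∧
    ∀ (M : Type u) [IncLang.Structure M] (v : Fin k → M),
      ψ.Realize v ↔ ∃ xs : Fin b → M, SameQFPattern w (Sum.elim v xs)

namespace IncQE

/-- A complete quantifier-free pattern on an index type. -/
abbrev Pat (ι : Type*) := (ι → ι → Prop) × (ι → Prop) × (ι → Prop) × (ι → ι → Prop)

/-- The pattern of a tuple. -/
def pat {ι : Type*} {M : Type*} [IncLang.Structure M] (x : ι → M) : Pat ι :=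
  (fun i j => x i = x j, fun i => ptL (x i), fun i => lnL (x i), fun i j => incL (x i) (x j))

/-- Two tuples have the same quantifier-free type. -/
structure SP {ι : Type*} {M N : Type*} [IncLang.Structure M] [IncLang.Structure N]
    (x : ι → M) (y : ι → N) : Prop where
  eq : ∀ i j, x i = x j ↔ y i = y j
  pt : ∀ i, ptL (x i) ↔ ptL (y i)
  ln : ∀ i, lnL (x i) ↔ lnL (y i)
  inc : ∀ i j, incL (x i) (x j) ↔ incL (y i) (y j)

theorem SP.symm {ι : Type*} {M N : Type*} [IncLang.Structure M] [IncLang.Structure N]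
    {x : ι → M} {y : ι → N} (h : SP x y) : SP y x :=
  ⟨fun i j => (h.eq i j).symm, fun i => (h.pt i).symm, fun i => (h.ln i).symm,
    fun i j => (h.inc i j).symm⟩

theorem SP.comp {ι κ : Type*} {M N : Type*} [IncLang.Structure M] [IncLang.Structure N]
    {x : ι → M} {y : ι → N} (h : SP x y) (e : κ → ι) : SP (x ∘ e) (y ∘ e) :=
  ⟨fun _ _ => h.eq _ _, fun _ => h.pt _, fun _ => h.ln _, fun _ _ => h.inc _ _⟩

theorem sp_iff_pat {ι : Type*} {M N : Type*} [IncLang.Structure M] [IncLang.Structure N]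
    {x : ι → M} {y : ι → N} : SP x y ↔ pat x = pat y := by
  constructor
  · intro h
    simp only [pat, Prod.mk.injEq]
    exact ⟨by ext i j; exact h.eq i j, by ext i; exact h.pt i, by ext i; exact h.ln i,
      by ext i j; exact h.inc i j⟩
  · intro h
    simp only [pat, Prod.mk.injEq] at h
    obtain ⟨h1, h2, h3, h4⟩ := h
    exact ⟨fun i j => iff_of_eq (congrFun (congrFun h1 i) j), fun i => iff_of_eq (congrFun h2 i),
      fun i => iff_of_eq (congrFun h3 i), fun i j => iff_of_eq (congrFun (congrFun h4 i) j)⟩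

theorem isQF_iInf {α β : Type*} {n : ℕ} [Finite β] (f : β → IncLang.BoundedFormula α n)
    (h : ∀ b, (f b).IsQF) : (BoundedFormula.iInf f).IsQF := by
  show BoundedFormula.IsQF (let _ := Fintype.ofFinite β; List.foldr _ _ _)
  simp only []
  generalize Finset.toList _ = l
  induction l with
  | nil => exact BoundedFormula.IsQF.top
  | cons a l ih => exact (h a).inf ih

open Classical in
/-- A formula or its negation. -/
noncomputable def lit {α : Type*} {n : ℕ} (φ : IncLang.BoundedFormula α n) (p : Prop) :
    IncLang.BoundedFormula α n := if p then φ else φ.not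

theorem lit_qf {α : Type*} {n : ℕ} {φ : IncLang.BoundedFormula α n} {p : Prop} (h : φ.IsQF) :
    (lit φ p).IsQF := by
  unfold lit; split_ifs
  · exact h
  · exact h.not

theorem lit_realize {α : Type*} {n : ℕ} {φ : IncLang.BoundedFormula α n} {p : Prop}
    {M : Type*} [IncLang.Structure M] {v : α → M} {xs : Fin n → M} :
    (lit φ p).Realize v xs ↔ (φ.Realize v xs ↔ p) := by
  unfold lit; split_ifs with h <;> simp [h]

theorem rz_pt {α : Type*} {n : ℕ} {t : IncLang.Term (α ⊕ Fin n)}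
    {M : Type*} [IncLang.Structure M] {v : α → M} {xs : Fin n → M} :
    (Relations.boundedFormula₁ (L := IncLang) IncRel.pt t).Realize v xs ↔
      ptL (t.realize (Sum.elim v xs)) := BoundedFormula.realize_rel₁

theorem rz_ln {α : Type*} {n : ℕ} {t : IncLang.Term (α ⊕ Fin n)}
    {M : Type*} [IncLang.Structure M] {v : α → M} {xs : Fin n → M} :
    (Relations.boundedFormula₁ (L := IncLang) IncRel.lin t).Realize v xs ↔
      lnL (t.realize (Sum.elim v xs)) := BoundedFormula.realize_rel₁

theorem rz_inc {α : Type*} {n : ℕ} {t s : IncLang.Term (α ⊕ Fin n)}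
    {M : Type*} [IncLang.Structure M] {v : α → M} {xs : Fin n → M} :
    (Relations.boundedFormula₂ (L := IncLang) IncRel.inc t s).Realize v xs ↔
      incL (t.realize (Sum.elim v xs)) (s.realize (Sum.elim v xs)) := BoundedFormula.realize_rel₂

/-- The diagram formula of a pattern. -/
noncomputable def diag {α ι : Type*} [Finite ι] {b : ℕ} (T : ι → α ⊕ Fin b) (p : Pat ι) :
    IncLang.BoundedFormula α b :=
  (BoundedFormula.iInf fun q : ι × ι =>
      lit (Term.bdEqual (Term.var (T q.1)) (Term.var (T q.2))) (p.1 q.1 q.2)) ⊓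
  ((BoundedFormula.iInf fun q : ι =>
      lit (Relations.boundedFormula₁ (L := IncLang) IncRel.pt (Term.var (T q))) (p.2.1 q)) ⊓
  ((BoundedFormula.iInf fun q : ι =>
      lit (Relations.boundedFormula₁ (L := IncLang) IncRel.lin (Term.var (T q))) (p.2.2.1 q)) ⊓
  (BoundedFormula.iInf fun q : ι × ι =>
      lit (Relations.boundedFormula₂ (L := IncLang) IncRel.inc (Term.var (T q.1))
        (Term.var (T q.2))) (p.2.2.2 q.1 q.2))))

theorem diag_qf {α ι : Type*} [Finite ι] {b : ℕ} (T : ι → α ⊕ Fin b) (p : Pat ι) :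
    (diag T p).IsQF := by
  refine .inf (isQF_iInf _ fun q => lit_qf ?_) (.inf (isQF_iInf _ fun q => lit_qf ?_)
    (.inf (isQF_iInf _ fun q => lit_qf ?_) (isQF_iInf _ fun q => lit_qf ?_)))
  · exact (BoundedFormula.IsAtomic.equal _ _).isQF
  all_goals exact (BoundedFormula.IsAtomic.rel _ _).isQF

theorem diag_realize {α ι : Type*} [Finite ι] {b : ℕ} (T : ι → α ⊕ Fin b) (p : Pat ι)
    {M : Type*} [IncLang.Structure M] {v : α → M} {xs : Fin b → M} :
    (diag T p).Realize v xs ↔ pat (fun i => Sum.elim v xs (T i)) = p := by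
  obtain ⟨p1, p2, p3, p4⟩ := p
  simp only [diag, BoundedFormula.realize_inf, BoundedFormula.realize_iInf, lit_realize,
    BoundedFormula.realize_bdEqual, rz_pt, rz_ln, rz_inc,
    Term.realize_var, pat, Prod.mk.injEq, funext_iff, eq_iff_iff, Prod.forall]

/-- Using existential closedness: tuples in an extension can be pulled back. -/
theorem ec_pull {m n : ℕ} {N : Type u} [IncLang.Structure N] (hN : IsECL m n N)
    {N' : Type u} [IncLang.Structure N'] (h1 : IsIncidenceL N') (h2 : KFreeL m n N')
    (f : N ↪[IncLang] N') {ι : Type*} [Finite ι] (t : ι → N') :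
    ∃ t' : ι → N, SP t t' ∧ ∀ i p, t i = f p → t' i = p := by
  classical
  obtain ⟨b, ⟨e⟩⟩ := Finite.exists_equiv_fin ι
  let J := {i : ι // ∃ p, t i = f p}
  let pr : J → N := fun j => j.2.choose
  have hpr : ∀ j : J, t j.1 = f (pr j) := fun j => j.2.choose_spec
  let T : ι ⊕ J → N ⊕ Fin b := Sum.elim (fun i => Sum.inr (e i)) (fun j => Sum.inl (pr j))
  let u : ι ⊕ J → N' := Sum.elim t (fun j => f (pr j))
  obtain ⟨xs, hxs⟩ := hN.2.2 N' h1 h2 f b (diag T (pat u)) (diag_qf _ _) ⟨t ∘ e.symm, by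
    rw [diag_realize]
    congr 1
    ext i
    rcases i with i | j <;> simp [T, u]⟩
  rw [diag_realize, ← sp_iff_pat] at hxs
  refine ⟨xs ∘ e, ?_, ?_⟩
  · exact (hxs.comp Sum.inl).symm
  · intro i p hp
    let j : J := ⟨i, p, hp⟩
    have := (hxs.eq (Sum.inl i) (Sum.inr j)).2 (hpr j)
    have h3 : pr j = p := f.injective ((hpr j).symm.trans hp)
    simpa [T, h3] using this

/-- One step of the `I`-closure. -/
def step (m n : ℕ) {M : Type*} [IncLang.Structure M] (S : Set M) : Set M :=
  {z | z ∈ S ∨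
    (∃ a : Fin m → M, Function.Injective a ∧ (∀ i, ptL (a i)) ∧ (∀ i, a i ∈ S) ∧
      ∀ i, incL (a i) z) ∨
    (∃ b : Fin n → M, Function.Injective b ∧ (∀ i, lnL (b i)) ∧ (∀ i, b i ∈ S) ∧
      ∀ i, incL z (b i))}

/-- The `d`-step closure. -/
def cl (m n : ℕ) {M : Type*} [IncLang.Structure M] (S : Set M) : ℕ → Set M
  | 0 => S
  | d + 1 => step m n (cl m n S d)

theorem step_mono {m n : ℕ} {M : Type*} [IncLang.Structure M] {S T : Set M} (h : S ⊆ T) :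
    step m n S ⊆ step m n T := by
  rintro z (hz | ⟨a, h1, h2, h3, h4⟩ | ⟨a, h1, h2, h3, h4⟩)
  · exact Or.inl (h hz)
  · exact Or.inr (Or.inl ⟨a, h1, h2, fun i => h (h3 i), h4⟩)
  · exact Or.inr (Or.inr ⟨a, h1, h2, fun i => h (h3 i), h4⟩)

theorem cl_mono {m n : ℕ} {M : Type*} [IncLang.Structure M] {S : Set M} {i j : ℕ} (h : i ≤ j) :
    cl m n S i ⊆ cl m n S j := by
  induction h with
  | refl => exact subset_rfl
  | step _ ih => exact ih.trans fun z hz => Or.inl hz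

/-- `S` is contained in a finite set of size at most `c`. -/
def Le {M : Type*} (c : ℕ) (S : Set M) : Prop := ∃ F : Finset M, S ⊆ ↑F ∧ F.card ≤ c

theorem le_of_no_inj {M : Type*} {n : ℕ} {S : Set M}
    (h : ¬ ∃ b : Fin n → M, Function.Injective b ∧ ∀ j, b j ∈ S) : Le n S := by
  by_contra hc
  apply h
  have : (n : ℕ∞) ≤ S.encard := by
    by_contra hlt
    push Not at hlt
    have hf : S.Finite := Set.encard_lt_top_iff.1 (hlt.trans (by simp))
    refine hc ⟨hf.toFinset, by simp, ?_⟩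
    rw [hf.encard_eq_coe_toFinset_card] at hlt
    exact_mod_cast hlt.le
  obtain ⟨t, ht, hcard⟩ := Set.exists_subset_encard_eq this
  have hf : t.Finite := Set.finite_of_encard_eq_coe hcard
  rw [hf.encard_eq_coe_toFinset_card] at hcard
  have hcard' : hf.toFinset.card = n := by exact_mod_cast hcard
  let e := hf.toFinset.equivFinOfCardEq hcard'
  refine ⟨fun j => (e.symm j).1, fun i j hij => e.symm.injective (Subtype.ext hij), fun j => ?_⟩
  exact ht (hf.mem_toFinset.1 (e.symm j).2)

theorem le_step {m n : ℕ} (hm : 1 ≤ m) (hn : 1 ≤ n) {M : Type*} [IncLang.Structure M]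
    (h1 : IsIncidenceL M) (h2 : KFreeL m n M)
    {S : Set M} {c : ℕ} (hS : Le c S) : Le (c + c ^ m * n + c ^ n * m) (step m n S) := by
  classical
  obtain ⟨F, hSF, hF⟩ := hS
  have hA : ∀ a : Fin m → M, Le n {z | (Function.Injective a ∧ (∀ i, ptL (a i))) ∧
      ∀ i, incL (a i) z} := by
    intro a
    apply le_of_no_inj
    rintro ⟨b, hb, hb'⟩
    have j0 : Fin n := ⟨0, hn⟩
    exact h2 ⟨a, b, (hb' j0).1.1, hb, (hb' j0).1.2,
      fun j => (h1.2.2 _ _ ((hb' j).2 ⟨0, hm⟩)).2, fun i j => (hb' j).2 i⟩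
  have hB : ∀ b : Fin n → M, Le m {z | (Function.Injective b ∧ (∀ i, lnL (b i))) ∧
      ∀ i, incL z (b i)} := by
    intro b
    apply le_of_no_inj
    rintro ⟨a, ha, ha'⟩
    have j0 : Fin m := ⟨0, hm⟩
    exact h2 ⟨a, b, ha, (ha' j0).1.1, fun j => (h1.2.2 _ _ ((ha' j).2 ⟨0, hn⟩)).1,
      (ha' j0).1.2, fun i j => (ha' i).2 j⟩
  choose FA hFA hFA' using hA
  choose FB hFB hFB' using hB
  refine ⟨F ∪ (Fintype.piFinset fun _ : Fin m => F).biUnion FA ∪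
    (Fintype.piFinset fun _ : Fin n => F).biUnion FB, ?_, ?_⟩
  · rintro z (hz | ⟨a, h1, h2, h3, h4⟩ | ⟨a, h1, h2, h3, h4⟩)
    · have := hSF hz
      simp only [Finset.coe_union, Set.mem_union]
      exact Or.inl (Or.inl this)
    · simp only [Finset.coe_union, Set.mem_union, Finset.mem_coe, Finset.mem_biUnion,
        Fintype.mem_piFinset]
      exact Or.inl (Or.inr ⟨a, fun i => hSF (h3 i), hFA a ⟨⟨h1, h2⟩, h4⟩⟩)
    · simp only [Finset.coe_union, Set.mem_union, Finset.mem_coe, Finset.mem_biUnion,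
        Fintype.mem_piFinset]
      exact Or.inr ⟨a, fun i => hSF (h3 i), hFB a ⟨⟨h1, h2⟩, h4⟩⟩
  · refine (Finset.card_union_le _ _).trans (add_le_add ((Finset.card_union_le _ _).trans
      (add_le_add hF ?_)) ?_)
    · refine (Finset.card_biUnion_le_card_mul _ _ n fun a _ => hFA' a).trans ?_
      simp only [Fintype.card_piFinset, Finset.prod_const, Finset.card_univ, Fintype.card_fin]
      gcongr
    · refine (Finset.card_biUnion_le_card_mul _ _ m fun a _ => hFB' a).trans ?_
      simp only [Fintype.card_piFinset, Finset.prod_const, Finset.card_univ, Fintype.card_fin]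
      gcongr

/-- Bound on the size of closures. -/
def bd (m n c : ℕ) : ℕ → ℕ
  | 0 => c
  | d + 1 => bd m n c d + (bd m n c d) ^ m * n + (bd m n c d) ^ n * m

theorem le_cl {m n : ℕ} (hm : 1 ≤ m) (hn : 1 ≤ n) {M : Type*} [IncLang.Structure M]
    (h1 : IsIncidenceL M) (h2 : KFreeL m n M)
    {S : Set M} {c : ℕ} (hS : Le c S) (d : ℕ) : Le (bd m n c d) (cl m n S d) := by
  induction d with
  | zero => exact hS
  | succ d ih => exact le_step hm hn h1 h2 ih

/-- Every `m` points have `n-1` common lines and dually. -/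
def Full (m n : ℕ) (M : Type*) [IncLang.Structure M] : Prop :=
  (∀ a : Fin m → M, Function.Injective a → (∀ i, ptL (a i)) → ∀ j, j + 1 ≤ n →
    ∃ b : Fin j → M, Function.Injective b ∧ (∀ j, lnL (b j)) ∧ ∀ i j, incL (a i) (b j)) ∧
  (∀ b : Fin n → M, Function.Injective b → (∀ i, lnL (b i)) → ∀ j, j + 1 ≤ m →
    ∃ a : Fin j → M, Function.Injective a ∧ (∀ j, ptL (a j)) ∧ ∀ i j, incL (a i) (b j))

theorem step_image {m n : ℕ} (hm : 1 ≤ m) (hn : 1 ≤ n)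
    {M N κ : Type*} [IncLang.Structure M] [IncLang.Structure N]
    (hM : Full m n M) (h1 : IsIncidenceL N) (h2 : KFreeL m n N) {x : κ → M} {y : κ → N}
    (h : SP x y) (S : Set κ) (hS : step m n (x '' S) ⊆ Set.range x) :
    step m n (y '' S) = y '' (x ⁻¹' step m n (x '' S)) := by
  apply Set.Subset.antisymm
  · rintro z (hz | ⟨a, ha1, ha2, ha3, ha4⟩ | ⟨b, hb1, hb2, hb3, hb4⟩)
    · obtain ⟨s, hs, rfl⟩ := hz
      exact ⟨s, Or.inl ⟨s, hs, rfl⟩, rfl⟩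
    · choose s hs hsa using ha3
      obtain rfl : y ∘ s = a := funext hsa
      have inj : Function.Injective (x ∘ s) := fun i j hij => ha1 ((h.eq _ _).1 hij)
      have pts : ∀ i, ptL ((x ∘ s) i) := fun i => (h.pt _).2 (ha2 i)
      obtain ⟨n', rfl⟩ : ∃ n', n = n' + 1 := ⟨n - 1, by omega⟩
      obtain ⟨b, hb1, hb2, hb3⟩ := hM.1 _ inj pts n' le_rfl
      have hbs : ∀ j, b j ∈ step m (n' + 1) (x '' S) := fun j =>
        Or.inr (Or.inl ⟨x ∘ s, inj, pts, fun i => ⟨s i, hs i, rfl⟩, fun i => hb3 i j⟩)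
      choose t ht using fun j => hS (hbs j)
      obtain rfl : x ∘ t = b := funext ht
      by_cases hz : ∃ j, y (t j) = z
      · obtain ⟨j, rfl⟩ := hz
        exact ⟨t j, hbs j, rfl⟩
      · exfalso
        push Not at hz
        refine h2 ⟨y ∘ s, Fin.cons z (y ∘ t), ha1, ?_, ha2, ?_, ?_⟩
        · rw [Fin.cons_injective_iff]
          refine ⟨?_, fun i j hij => hb1 ((h.eq _ _).2 hij)⟩
          rintro ⟨j, hj⟩
          exact hz j hj
        · intro j
          refine Fin.cases ?_ (fun j => ?_) j
          · exact (h1.2.2 _ _ (ha4 ⟨0, hm⟩)).2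
          · exact (h.ln _).1 (hb2 j)
        · intro i j
          refine Fin.cases ?_ (fun j => ?_) j
          · exact ha4 i
          · exact (h.inc _ _).1 (hb3 i j)
    · choose s hs hsa using hb3
      obtain rfl : y ∘ s = b := funext hsa
      have inj : Function.Injective (x ∘ s) := fun i j hij => hb1 ((h.eq _ _).1 hij)
      have lns : ∀ i, lnL ((x ∘ s) i) := fun i => (h.ln _).2 (hb2 i)
      obtain ⟨m', rfl⟩ : ∃ m', m = m' + 1 := ⟨m - 1, by omega⟩
      obtain ⟨a, ha1, ha2, ha3⟩ := hM.2 _ inj lns m' le_rfl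
      have has : ∀ j, a j ∈ step (m' + 1) n (x '' S) := fun j =>
        Or.inr (Or.inr ⟨x ∘ s, inj, lns, fun i => ⟨s i, hs i, rfl⟩, fun i => ha3 j i⟩)
      choose t ht using fun j => hS (has j)
      obtain rfl : x ∘ t = a := funext ht
      by_cases hz : ∃ j, y (t j) = z
      · obtain ⟨j, rfl⟩ := hz
        exact ⟨t j, has j, rfl⟩
      · exfalso
        push Not at hz
        refine h2 ⟨Fin.cons z (y ∘ t), y ∘ s, ?_, hb1, ?_, hb2, ?_⟩
        · rw [Fin.cons_injective_iff]
          refine ⟨?_, fun i j hij => ha1 ((h.eq _ _).2 hij)⟩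
          rintro ⟨j, hj⟩
          exact hz j hj
        · intro j
          refine Fin.cases ?_ (fun j => ?_) j
          · exact (h1.2.2 _ _ (hb4 ⟨0, hn⟩)).1
          · exact (h.pt _).1 (ha2 j)
        · intro j i
          refine Fin.cases ?_ (fun j => ?_) j
          · exact hb4 i
          · exact (h.inc _ _).1 (ha3 j i)
  · rintro _ ⟨k, hz | ⟨a, ha1, ha2, ha3, ha4⟩ | ⟨b, hb1, hb2, hb3, hb4⟩, rfl⟩
    · obtain ⟨s, hs, hsk⟩ := hz
      exact Or.inl ⟨s, hs, (h.eq _ _).1 hsk⟩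
    · choose s hs hsa using ha3
      obtain rfl : x ∘ s = a := funext hsa
      exact Or.inr (Or.inl ⟨y ∘ s, fun i j hij => ha1 ((h.eq _ _).2 hij),
        fun i => (h.pt _).1 (ha2 i), fun i => ⟨s i, hs i, rfl⟩, fun i => (h.inc _ _).1 (ha4 i)⟩)
    · choose s hs hsa using hb3
      obtain rfl : x ∘ s = b := funext hsa
      exact Or.inr (Or.inr ⟨y ∘ s, fun i j hij => hb1 ((h.eq _ _).2 hij),
        fun i => (h.ln _).1 (hb2 i), fun i => ⟨s i, hs i, rfl⟩, fun i => (h.inc _ _).1 (hb4 i)⟩)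

theorem cl_image {m n : ℕ} (hm : 1 ≤ m) (hn : 1 ≤ n)
    {M N κ : Type*} [IncLang.Structure M] [IncLang.Structure N]
    (hM : Full m n M) (h1 : IsIncidenceL N) (h2 : KFreeL m n N) {x : κ → M} {y : κ → N}
    (h : SP x y) {V : Set M} {W : Set N} (hW : W = y '' (x ⁻¹' V)) {d : ℕ}
    (hV : cl m n V d ⊆ Set.range x) :
    cl m n W d = y '' (x ⁻¹' cl m n V d) := by
  induction d with
  | zero => exact hW
  | succ d ih =>
    have h0 : cl m n V d ⊆ Set.range x := (cl_mono (Nat.le_succ d)).trans hV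
    have h3 : x '' (x ⁻¹' cl m n V d) = cl m n V d := Set.image_preimage_eq_of_subset h0
    have := step_image hm hn hM h1 h2 h (x ⁻¹' cl m n V d) (by rw [h3]; exact hV)
    rw [h3, ← ih h0] at this
    exact this

/-- Build a structure from its relations. -/
@[reducible] def mkStr {A : Type*} (P L : A → Prop) (I : A → A → Prop) : IncLang.Structure A where
  funMap := fun f => Empty.elim f
  RelMap := fun {k} r x =>
    match k, r, x with
    | _, IncRel.pt, x => P (x 0)
    | _, IncRel.lin, x => L (x 0)
    | _, IncRel.inc, x => I (x 0) (x 1)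

/-- Embeddings from preservation of the basic relations. -/
def mkEmb {N N' : Type*} [IncLang.Structure N] [IncLang.Structure N'] (f : N → N')
    (hf : Function.Injective f) (h1 : ∀ x, ptL (f x) ↔ ptL x) (h2 : ∀ x, lnL (f x) ↔ lnL x)
    (h3 : ∀ x y, incL (f x) (f y) ↔ incL x y) : N ↪[IncLang] N' where
  toFun := f
  inj' := hf
  map_fun' := fun g => Empty.elim g
  map_rel' := by
    intro k r x
    cases r with
    | pt =>
      have e : x = ![x 0] := by ext i; fin_cases i; rfl
      have e' : f ∘ x = ![f (x 0)] := by ext i; fin_cases i; rfl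
      rw [e', e]; exact h1 (x 0)
    | lin =>
      have e : x = ![x 0] := by ext i; fin_cases i; rfl
      have e' : f ∘ x = ![f (x 0)] := by ext i; fin_cases i; rfl
      rw [e', e]; exact h2 (x 0)
    | inc =>
      have e : x = ![x 0, x 1] := by ext i; fin_cases i <;> rfl
      have e' : f ∘ x = ![f (x 0), f (x 1)] := by ext i; fin_cases i <;> rfl
      rw [e', e]; exact h3 (x 0) (x 1)

/-- Existential closedness, for extensions `N ⊕ E` given by explicit relations. -/
theorem ec_ext {m n : ℕ} {N : Type u} [IncLang.Structure N] (hN : IsECL m n N)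
    {E : Type u} (P L : N ⊕ E → Prop) (I : N ⊕ E → N ⊕ E → Prop)
    (hP : ∀ x, P (Sum.inl x) ↔ ptL x) (hL : ∀ x, L (Sum.inl x) ↔ lnL x)
    (hI : ∀ x y, I (Sum.inl x) (Sum.inl y) ↔ incL x y)
    (hPL : ∀ z, P z ∨ L z) (hPL' : ∀ z, ¬ (P z ∧ L z)) (hinc : ∀ z w, I z w → P z ∧ L w)
    (hK : ∀ (a : Fin m → N ⊕ E) (b : Fin n → N ⊕ E), Function.Injective a →
      Function.Injective b → (∀ i, P (a i)) → (∀ j, L (b j)) → (∀ i j, I (a i) (b j)) → False)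
    {ι : Type*} [Finite ι] (t : ι → N ⊕ E) :
    ∃ t' : ι → N, ((∀ i j, t i = t j ↔ t' i = t' j) ∧ (∀ i, P (t i) ↔ ptL (t' i)) ∧
      (∀ i, L (t i) ↔ lnL (t' i)) ∧ (∀ i j, I (t i) (t j) ↔ incL (t' i) (t' j))) ∧
      ∀ i p, t i = Sum.inl p → t' i = p := by
  let _ : IncLang.Structure (N ⊕ E) := mkStr P L I
  have h1 : IsIncidenceL (N ⊕ E) := ⟨hPL, hPL', hinc⟩
  have h2 : KFreeL m n (N ⊕ E) := by
    rintro ⟨a, b, ha, hb, h1, h2, h3⟩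
    exact hK a b ha hb h1 h2 h3
  obtain ⟨t', ht, ht'⟩ := ec_pull hN h1 h2 (mkEmb Sum.inl Sum.inl_injective hP hL hI) t
  exact ⟨t', ⟨ht.eq, ht.pt, ht.ln, ht.inc⟩, ht'⟩

theorem full_lines {m n : ℕ} (hn : 1 ≤ n) {N : Type u} [IncLang.Structure N] (hN : IsECL m n N)
    (a : Fin m → N) (ha : Function.Injective a) (hpt : ∀ i, ptL (a i)) (j : ℕ) (hj : j + 1 ≤ n) :
    ∃ b : Fin j → N, Function.Injective b ∧ (∀ j, lnL (b j)) ∧ ∀ i j, incL (a i) (b j) := by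
  induction j with
  | zero => exact ⟨Fin.elim0, fun i => i.elim0, fun i => i.elim0, fun _ i => i.elim0⟩
  | succ j ih =>
    obtain ⟨b, hb1, hb2, hb3⟩ := ih (by omega)
    suffices hs : ∃ z, lnL z ∧ (∀ i, incL (a i) z) ∧ z ∉ Set.range b by
      obtain ⟨z, hz1, hz2, hz3⟩ := hs
      refine ⟨Fin.cons z b, ?_, ?_, ?_⟩
      · rw [Fin.cons_injective_iff]; exact ⟨hz3, hb1⟩
      · intro j; exact Fin.cases hz1 hb2 j
      · intro i j; exact Fin.cases (hz2 i) (hb3 i) j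
    by_contra hno
    push Not at hno
    let P : N ⊕ PUnit.{u+1} → Prop := Sum.elim ptL (fun _ => False)
    let L : N ⊕ PUnit.{u+1} → Prop := Sum.elim lnL (fun _ => True)
    let I : N ⊕ PUnit.{u+1} → N ⊕ PUnit.{u+1} → Prop :=
      Sum.elim (fun p => Sum.elim (fun q => incL p q) (fun _ => p ∈ Set.range a))
        (fun _ _ => False)
    let t : Option (Fin m ⊕ Fin j) → N ⊕ PUnit.{u+1} := fun o =>
      o.elim (Sum.inr PUnit.unit) (fun s => Sum.inl (Sum.elim a b s))
    obtain ⟨t', ⟨e1, e2, e3, e4⟩, e5⟩ := ec_ext hN P L I (fun _ => Iff.rfl) (fun _ => Iff.rfl)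
      (fun _ _ => Iff.rfl)
      (by rintro (p | p)
          · exact hN.1.1 p
          · exact Or.inr trivial)
      (by rintro (p | p)
          · exact hN.1.2.1 p
          · exact fun h => h.1)
      (by rintro (p | p) (q | q)
          · exact hN.1.2.2 p q
          · rintro ⟨i, rfl⟩; exact ⟨hpt i, trivial⟩
          · exact False.elim
          · exact False.elim)
      (by
        intro A B hA hB hAP hBL hAB
        have hA' : ∀ i, ∃ p, A i = Sum.inl p := by
          intro i
          have := hAP i
          rcases h : A i with p | p
          · exact ⟨p, rfl⟩
          · rw [h] at this; exact False.elim this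
        choose A' hA' using hA'
        by_cases hall : ∀ j, ∃ q, B j = Sum.inl q
        · choose B' hB' using hall
          refine hN.2.1 ⟨A', B', fun i j h => hA (by rw [hA', hA', h]),
            fun i j h => hB (by rw [hB', hB', h]), fun i => ?_, fun i => ?_, fun i j => ?_⟩
          · have := hAP i; rw [hA'] at this; exact this
          · have := hBL i; rw [hB'] at this; exact this
          · have := hAB i j; rw [hA', hB'] at this; exact this
        · push Not at hall
          obtain ⟨j0, hj0⟩ := hall
          have hr : ∀ i, ∃ s, a s = A' i := by
            intro i
            have := hAB i j0
            rcases hB0 : B j0 with q | q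
            · exact (hj0 q hB0).elim
            · rw [hA', hB0] at this; exact this
          choose s hs using hr
          have hsi : Function.Injective s := fun i j h => hA (by rw [hA', hA', ← hs, ← hs, h])
          have hss := Finite.surjective_of_injective hsi
          have hB' : ∀ k, ∃ o : Option (Fin j), B k = o.elim (Sum.inr PUnit.unit)
              (fun s => Sum.inl (b s)) := by
            intro k
            rcases hBk : B k with q | q
            · have hq : ∀ i, incL (a i) q := by
                intro i
                obtain ⟨i', rfl⟩ := hss i
                have := hAB i' k
                rw [hA', hBk] at this
                rw [hs]; exact this
              have hl : lnL q := by have := hBL k; rw [hBk] at this; exact this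
              obtain ⟨w, rfl⟩ := hno q hl hq
              exact ⟨some w, rfl⟩
            · exact ⟨none, rfl⟩
          choose o ho using hB'
          have hoi : Function.Injective o := fun i j h => hB (by rw [ho, ho, h])
          have := Fintype.card_le_of_injective o hoi
          simp at this
          omega) t
    have hz : lnL (t' none) := (e3 none).1 trivial
    have ha' : ∀ i, t' (some (Sum.inl i)) = a i := fun i => e5 _ _ rfl
    have hb' : ∀ i, t' (some (Sum.inr i)) = b i := fun i => e5 _ _ rfl
    obtain ⟨w, hw⟩ := hno (t' none) hz (fun i => by
      rw [← ha' i]; exact (e4 _ _).1 ⟨i, rfl⟩)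
    rw [← hb' w] at hw
    have := (e1 _ _).2 hw
    exact absurd this (by simp [t])

theorem full_points {m n : ℕ} (hm : 1 ≤ m) {N : Type u} [IncLang.Structure N] (hN : IsECL m n N)
    (b : Fin n → N) (hb : Function.Injective b) (hln : ∀ i, lnL (b i)) (j : ℕ) (hj : j + 1 ≤ m) :
    ∃ a : Fin j → N, Function.Injective a ∧ (∀ j, ptL (a j)) ∧ ∀ i j, incL (a i) (b j) := by
  induction j with
  | zero => exact ⟨Fin.elim0, fun i => i.elim0, fun i => i.elim0, fun i => i.elim0⟩
  | succ j ih =>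
    obtain ⟨a, ha1, ha2, ha3⟩ := ih (by omega)
    suffices hs : ∃ z, ptL z ∧ (∀ i, incL z (b i)) ∧ z ∉ Set.range a by
      obtain ⟨z, hz1, hz2, hz3⟩ := hs
      refine ⟨Fin.cons z a, ?_, ?_, ?_⟩
      · rw [Fin.cons_injective_iff]; exact ⟨hz3, ha1⟩
      · intro j; exact Fin.cases hz1 ha2 j
      · intro i j; exact Fin.cases (hz2 j) (fun i => ha3 i j) i
    by_contra hno
    push Not at hno
    let P : N ⊕ PUnit.{u+1} → Prop := Sum.elim ptL (fun _ => True)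
    let L : N ⊕ PUnit.{u+1} → Prop := Sum.elim lnL (fun _ => False)
    let I : N ⊕ PUnit.{u+1} → N ⊕ PUnit.{u+1} → Prop :=
      Sum.elim (fun p => Sum.elim (fun q => incL p q) (fun _ => False))
        (fun _ => Sum.elim (fun q => q ∈ Set.range b) (fun _ => False))
    let t : Option (Fin n ⊕ Fin j) → N ⊕ PUnit.{u+1} := fun o =>
      o.elim (Sum.inr PUnit.unit) (fun s => Sum.inl (Sum.elim b a s))
    obtain ⟨t', ⟨e1, e2, e3, e4⟩, e5⟩ := ec_ext hN P L I (fun _ => Iff.rfl) (fun _ => Iff.rfl)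
      (fun _ _ => Iff.rfl)
      (by rintro (p | p)
          · exact hN.1.1 p
          · exact Or.inl trivial)
      (by rintro (p | p)
          · exact hN.1.2.1 p
          · exact fun h => h.2)
      (by rintro (p | p) (q | q)
          · exact hN.1.2.2 p q
          · exact False.elim
          · rintro ⟨i, rfl⟩; exact ⟨trivial, hln i⟩
          · exact False.elim)
      (by
        intro A B hA hB hAP hBL hAB
        have hB' : ∀ i, ∃ p, B i = Sum.inl p := by
          intro i
          have := hBL i
          rcases h : B i with p | p
          · exact ⟨p, rfl⟩
          · rw [h] at this; exact False.elim this
        choose B' hB' using hB'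
        by_cases hall : ∀ j, ∃ q, A j = Sum.inl q
        · choose A' hA' using hall
          refine hN.2.1 ⟨A', B', fun i j h => hA (by rw [hA', hA', h]),
            fun i j h => hB (by rw [hB', hB', h]), fun i => ?_, fun i => ?_, fun i j => ?_⟩
          · have := hAP i; rw [hA'] at this; exact this
          · have := hBL i; rw [hB'] at this; exact this
          · have := hAB i j; rw [hA', hB'] at this; exact this
        · push Not at hall
          obtain ⟨j0, hj0⟩ := hall
          have hr : ∀ i, ∃ s, b s = B' i := by
            intro i
            have := hAB j0 i
            rcases hA0 : A j0 with q | q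
            · exact (hj0 q hA0).elim
            · rw [hB', hA0] at this; exact this
          choose s hs using hr
          have hsi : Function.Injective s := fun i j h => hB (by rw [hB', hB', ← hs, ← hs, h])
          have hss := Finite.surjective_of_injective hsi
          have hA' : ∀ k, ∃ o : Option (Fin j), A k = o.elim (Sum.inr PUnit.unit)
              (fun s => Sum.inl (a s)) := by
            intro k
            rcases hAk : A k with q | q
            · have hq : ∀ i, incL q (b i) := by
                intro i
                obtain ⟨i', rfl⟩ := hss i
                have := hAB k i'
                rw [hB', hAk] at this
                rw [hs]; exact this
              have hl : ptL q := by have := hAP k; rw [hAk] at this; exact this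
              obtain ⟨w, rfl⟩ := hno q hl hq
              exact ⟨some w, rfl⟩
            · exact ⟨none, rfl⟩
          choose o ho using hA'
          have hoi : Function.Injective o := fun i j h => hA (by rw [ho, ho, h])
          have := Fintype.card_le_of_injective o hoi
          simp at this
          omega) t
    have hz : ptL (t' none) := (e2 none).1 trivial
    have hb' : ∀ i, t' (some (Sum.inl i)) = b i := fun i => e5 _ _ rfl
    have ha' : ∀ i, t' (some (Sum.inr i)) = a i := fun i => e5 _ _ rfl
    obtain ⟨w, hw⟩ := hno (t' none) hz (fun i => by
      rw [← hb' i]; exact (e4 _ _).1 ⟨i, rfl⟩)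
    rw [← ha' w] at hw
    have := (e1 _ _).2 hw
    exact absurd this (by simp [t])

theorem ec_full {m n : ℕ} (hm : 1 ≤ m) (hn : 1 ≤ n) {N : Type u} [IncLang.Structure N]
    (hN : IsECL m n N) : Full m n N := ⟨full_lines hn hN, full_points hm hN⟩

/-- Free amalgamation over an `I`-closed subset. -/
theorem amalg {m n : ℕ} {M N : Type u} [IncLang.Structure M] [IncLang.Structure N]
    (hM1 : IsIncidenceL M) (hM2 : KFreeL m n M) (hN : IsECL m n N)
    (Y C : Set M) (hY : Y.Finite) (hCY : C ⊆ Y) (hC : ∀ z ∈ Y, z ∈ step m n C → z ∈ C)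
    (g : C → N) (hg : SP (Subtype.val : C → M) g) :
    ∃ h : Y → N, SP (Subtype.val : Y → M) h ∧
      ∀ (c : M) (hc : c ∈ C), h ⟨c, hCY hc⟩ = g ⟨c, hc⟩ := by
  classical
  let E := {p : M // p ∈ Y ∧ p ∉ C}
  let P : N ⊕ E → Prop := Sum.elim ptL (fun e => ptL e.1)
  let L : N ⊕ E → Prop := Sum.elim lnL (fun e => lnL e.1)
  let I : N ⊕ E → N ⊕ E → Prop := Sum.elim
    (fun p => Sum.elim (fun q => incL p q) (fun e => ∃ c : C, g c = p ∧ incL c.1 e.1))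
    (fun e => Sum.elim (fun q => ∃ c : C, g c = q ∧ incL e.1 c.1) (fun e' => incL e.1 e'.1))
  let Cor : M → N ⊕ E → Prop := fun p z =>
    (∃ c : C, p = c.1 ∧ z = Sum.inl (g c)) ∨ (∃ e : E, p = e.1 ∧ z = Sum.inr e)
  have cor_eq : ∀ p z q w, Cor p z → Cor q w → (p = q ↔ z = w) := by
    rintro p z q w (⟨c, rfl, rfl⟩ | ⟨e, rfl, rfl⟩) (⟨c', rfl, rfl⟩ | ⟨e', rfl, rfl⟩)
    · rw [Sum.inl.injEq]; exact hg.eq c c'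
    · simp only [reduceCtorEq, iff_false]
      intro h; exact e'.2.2 (h ▸ c.2)
    · simp only [reduceCtorEq, iff_false]
      intro h; exact e.2.2 (h ▸ c'.2)
    · rw [Sum.inr.injEq, Subtype.ext_iff]
  have cor_pt : ∀ p z, Cor p z → (ptL p ↔ P z) := by
    rintro p z (⟨c, rfl, rfl⟩ | ⟨e, rfl, rfl⟩)
    · exact hg.pt c
    · exact Iff.rfl
  have cor_ln : ∀ p z, Cor p z → (lnL p ↔ L z) := by
    rintro p z (⟨c, rfl, rfl⟩ | ⟨e, rfl, rfl⟩)
    · exact hg.ln c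
    · exact Iff.rfl
  have g_inj : ∀ c c', g c = g c' → c = c' := fun c c' h => Subtype.ext ((hg.eq c c').2 h)
  have cor_inc : ∀ p z q w, Cor p z → Cor q w → (incL p q ↔ I z w) := by
    rintro p z q w (⟨c, rfl, rfl⟩ | ⟨e, rfl, rfl⟩) (⟨c', rfl, rfl⟩ | ⟨e', rfl, rfl⟩)
    · exact hg.inc c c'
    · refine ⟨fun h => ⟨c, rfl, h⟩, ?_⟩
      rintro ⟨c', h1, h2⟩
      rwa [g_inj _ _ h1] at h2
    · refine ⟨fun h => ⟨c', rfl, h⟩, ?_⟩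
      rintro ⟨c, h1, h2⟩
      rwa [g_inj _ _ h1] at h2
    · exact Iff.rfl
  have cor_ex : ∀ p : Y, ∃ z, Cor p.1 z := by
    intro p
    by_cases h : p.1 ∈ C
    · exact ⟨_, Or.inl ⟨⟨p.1, h⟩, rfl, rfl⟩⟩
    · exact ⟨_, Or.inr ⟨⟨p.1, p.2, h⟩, rfl, rfl⟩⟩
  choose t ht using cor_ex
  have : Finite Y := hY
  obtain ⟨t', ⟨e1, e2, e3, e4⟩, e5⟩ := ec_ext hN P L I (fun _ => Iff.rfl) (fun _ => Iff.rfl)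
    (fun _ _ => Iff.rfl)
    (by rintro (p | p)
        · exact hN.1.1 p
        · exact hM1.1 p.1)
    (by rintro (p | p)
        · exact hN.1.2.1 p
        · exact hM1.2.1 p.1)
    (by rintro (p | p) (q | q)
        · exact hN.1.2.2 p q
        · rintro ⟨c, rfl, h⟩
          have := hM1.2.2 _ _ h
          exact ⟨(hg.pt c).1 this.1, this.2⟩
        · rintro ⟨c, rfl, h⟩
          have := hM1.2.2 _ _ h
          exact ⟨this.1, (hg.ln c).1 this.2⟩
        · exact hM1.2.2 p.1 q.1)
    (by
      intro A B hA hB hAP hBL hAB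
      have corB : ∀ i e j, A i = Sum.inr e → ∃ q, Cor q (B j) := by
        intro i e j hi
        have := hAB i j
        rw [hi] at this
        rcases h : B j with q | q
        · rw [h] at this
          obtain ⟨c, rfl, _⟩ := this
          exact ⟨c, Or.inl ⟨c, rfl, rfl⟩⟩
        · exact ⟨q, Or.inr ⟨q, rfl, rfl⟩⟩
      have corA : ∀ i e j, B j = Sum.inr e → ∃ q, Cor q (A i) := by
        intro i e j hi
        have := hAB i j
        rw [hi] at this
        rcases h : A i with q | q
        · rw [h] at this
          obtain ⟨c, rfl, _⟩ := this
          exact ⟨c, Or.inl ⟨c, rfl, rfl⟩⟩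
        · exact ⟨q, Or.inr ⟨q, rfl, rfl⟩⟩
      by_cases hAl : ∃ i e, A i = Sum.inr e
      · obtain ⟨i0, e0, he0⟩ := hAl
        by_cases hBl : ∃ j e, B j = Sum.inr e
        · obtain ⟨j1, e1, he1⟩ := hBl
          choose b hb using fun j => corB i0 e0 j he0
          choose a ha using fun i => corA i e1 j1 he1
          exact hM2 ⟨a, b, fun i j h => hA ((cor_eq _ _ _ _ (ha i) (ha j)).1 h),
            fun i j h => hB ((cor_eq _ _ _ _ (hb i) (hb j)).1 h),
            fun i => (cor_pt _ _ (ha i)).2 (hAP i), fun i => (cor_ln _ _ (hb i)).2 (hBL i),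
            fun i j => (cor_inc _ _ _ _ (ha i) (hb j)).2 (hAB i j)⟩
        · push Not at hBl
          have : ∀ j, ∃ c : C, B j = Sum.inl (g c) ∧ incL e0.1 c.1 := by
            intro j
            have h := hAB i0 j
            rw [he0] at h
            rcases hBj : B j with q | q
            · rw [hBj] at h
              obtain ⟨c, rfl, h⟩ := h
              exact ⟨c, rfl, h⟩
            · exact (hBl j q hBj).elim
          choose c hc1 hc2 using this
          refine e0.2.2 (hC _ e0.2.1 (Or.inr (Or.inr ⟨fun j => (c j).1, fun i j h => hB ?_,
            fun i => ?_, fun i => (c i).2, hc2⟩)))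
          · rw [hc1, hc1, Subtype.ext h]
          · have := hBL i
            rw [hc1] at this
            exact (hg.ln _).2 this
      · push Not at hAl
        have hA' : ∀ i, ∃ p, A i = Sum.inl p := by
          intro i
          rcases h : A i with p | p
          · exact ⟨p, rfl⟩
          · exact (hAl i p h).elim
        choose A' hA' using hA'
        by_cases hBl : ∃ j e, B j = Sum.inr e
        · obtain ⟨j0, e0, he0⟩ := hBl
          have : ∀ i, ∃ c : C, A i = Sum.inl (g c) ∧ incL c.1 e0.1 := by
            intro i
            have h := hAB i j0
            rw [he0, hA'] at h
            obtain ⟨c, hc, h⟩ := h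
            exact ⟨c, by rw [hA', hc], h⟩
          choose c hc1 hc2 using this
          refine e0.2.2 (hC _ e0.2.1 (Or.inr (Or.inl ⟨fun j => (c j).1, fun i j h => hA ?_,
            fun i => ?_, fun i => (c i).2, hc2⟩)))
          · rw [hc1, hc1, Subtype.ext h]
          · have := hAP i
            rw [hc1] at this
            exact (hg.pt _).2 this
        · push Not at hBl
          have hB' : ∀ i, ∃ p, B i = Sum.inl p := by
            intro i
            rcases h : B i with p | p
            · exact ⟨p, rfl⟩
            · exact (hBl i p h).elim
          choose B' hB' using hB'
          refine hN.2.1 ⟨A', B', fun i j h => hA (by rw [hA', hA', h]),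
            fun i j h => hB (by rw [hB', hB', h]), fun i => ?_, fun i => ?_, fun i j => ?_⟩
          · have := hAP i; rw [hA'] at this; exact this
          · have := hBL i; rw [hB'] at this; exact this
          · have := hAB i j; rw [hA', hB'] at this; exact this) t
  refine ⟨t', ⟨fun i j => (cor_eq _ _ _ _ (ht i) (ht j)).trans (e1 i j),
    fun i => (cor_pt _ _ (ht i)).trans (e2 i), fun i => (cor_ln _ _ (ht i)).trans (e3 i),
    fun i j => (cor_inc _ _ _ _ (ht i) (ht j)).trans (e4 i j)⟩, fun c hc => e5 _ _ ?_⟩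
  exact (cor_eq _ _ _ _ (ht ⟨c, hCY hc⟩) (Or.inl ⟨⟨c, hc⟩, rfl, rfl⟩)).1 rfl

/-- `v` and `w` have isomorphic `d`-step closures. -/
def Eqv (m n d : ℕ) {M N : Type u} [IncLang.Structure M] [IncLang.Structure N] {ι : Type}
    (v : ι → M) (w : ι → N) : Prop :=
  ∃ (κ : Type u) (x : κ → M) (y : κ → N), SP x y ∧ Set.range x = cl m n (Set.range v) d ∧
    Set.range y = cl m n (Set.range w) d ∧ ∀ i, ∃ k, x k = v i ∧ y k = w i

theorem Eqv.symm {m n d : ℕ} {M N : Type u} [IncLang.Structure M] [IncLang.Structure N] {ι : Type}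
    {v : ι → M} {w : ι → N} (h : Eqv m n d v w) : Eqv m n d w v := by
  obtain ⟨κ, x, y, h1, h2, h3, h4⟩ := h
  exact ⟨κ, y, x, h1.symm, h3, h2, fun i => (h4 i).imp fun k hk => hk.symm⟩

theorem Eqv.sp {m n d : ℕ} {M N : Type u} [IncLang.Structure M] [IncLang.Structure N] {ι : Type}
    {v : ι → M} {w : ι → N} (h : Eqv m n d v w) : SP v w := by
  obtain ⟨κ, x, y, h1, h2, h3, h4⟩ := h
  choose e he he' using h4
  obtain rfl : x ∘ e = v := funext he
  obtain rfl : y ∘ e = w := funext he'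
  exact h1.comp e

theorem Eqv.reindex {m n d : ℕ} {M N : Type u} [IncLang.Structure M] [IncLang.Structure N]
    {ι ι' : Type} {v : ι → M} {w : ι → N} (h : Eqv m n d v w) (s : ι' → ι)
    (hs : Function.Surjective s) : Eqv m n d (v ∘ s) (w ∘ s) := by
  obtain ⟨κ, x, y, h1, h2, h3, h4⟩ := h
  refine ⟨κ, x, y, h1, ?_, ?_, fun i => h4 (s i)⟩
  · rw [hs.range_comp]; exact h2
  · rw [hs.range_comp]; exact h3

theorem mkEqv {m n d : ℕ} (hm : 1 ≤ m) (hn : 1 ≤ n)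
    {M N : Type u} [IncLang.Structure M] [IncLang.Structure N]
    {ι : Type} {v : ι → M} {w : ι → N} (hM : IsECL m n M) (hN : IsECL m n N)
    {κ : Type u} {x : κ → M} {y : κ → N} (h : SP x y)
    (h2 : Set.range x = cl m n (Set.range v) d) (h4 : ∀ i, ∃ k, x k = v i ∧ y k = w i) :
    Eqv m n d v w := by
  refine ⟨κ, x, y, h, h2, ?_, h4⟩
  have hW : Set.range w = y '' (x ⁻¹' Set.range v) := by
    apply Set.Subset.antisymm
    · rintro _ ⟨i, rfl⟩
      obtain ⟨k, hk, hk'⟩ := h4 i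
      exact ⟨k, ⟨i, hk.symm⟩, hk'⟩
    · rintro _ ⟨k, ⟨i, hi⟩, rfl⟩
      obtain ⟨k', hk, hk'⟩ := h4 i
      exact ⟨i, by rw [← hk']; exact (h.eq _ _).1 (hk.trans hi)⟩
  rw [cl_image hm hn (ec_full hm hn hM) hN.1 hN.2.1 h hW h2.ge, ← h2]
  ext z; simp

theorem stab {M : Type*} (Y : Set M) (s : ℕ) (hY : Le s Y) (c : ℕ → Set M)
    (hc : ∀ i, c i ⊆ c (i + 1)) : ∃ i ≤ s, Y ∩ c (i + 1) ⊆ c i := by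
  by_contra hno
  push Not at hno
  obtain ⟨F, hF, hFs⟩ := hY
  have hfin : Y.Finite := F.finite_toSet.subset hF
  have hYs : Y.ncard ≤ s := by
    refine (Set.ncard_le_ncard hF F.finite_toSet).trans ?_
    rwa [Set.ncard_coe_finset]
  have key : ∀ i ≤ s + 1, i ≤ (Y ∩ c i).ncard := by
    intro i
    induction i with
    | zero => intro _; exact Nat.zero_le _
    | succ i ih =>
      intro hi
      have h1 := ih (by omega)
      have h2 : Y ∩ c i ⊂ Y ∩ c (i + 1) := by
        refine ⟨Set.inter_subset_inter_right _ (hc i), fun h => hno i (by omega) fun z hz => ?_⟩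
        exact (h hz).2
      have := Set.ncard_lt_ncard h2 (hfin.subset Set.inter_subset_left)
      omega
  have h1 := key (s + 1) le_rfl
  have h2 := Set.ncard_le_ncard (Set.inter_subset_left : Y ∩ c (s + 1) ⊆ Y) hfin
  omega

theorem le_range {M ι : Type*} [Fintype ι] (v : ι → M) : Le (Fintype.card ι) (Set.range v) := by
  classical
  exact ⟨Finset.univ.image v, by simp, Finset.card_image_le⟩

theorem forth {m n d D : ℕ} (hm : 1 ≤ m) (hn : 1 ≤ n) {ι : Type} [Fintype ι]
    (hD : bd m n (Fintype.card (Option ι)) d ≤ D)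
    {M N : Type u} [IncLang.Structure M] [IncLang.Structure N]
    {v : ι → M} {w : ι → N} (hM : IsECL m n M) (hN : IsECL m n N)
    (h : Eqv m n D v w) (c : M) :
    ∃ e : N, Eqv m n d (fun o : Option ι => o.elim c v) (fun o : Option ι => o.elim e w) := by
  let v' : Option ι → M := fun o => o.elim c v
  let Y := cl m n (Set.range v') d
  have hYle : Le (bd m n (Fintype.card (Option ι)) d) Y := le_cl hm hn hM.1 hM.2.1 (le_range v') d
  obtain ⟨i, hi, hst⟩ := stab Y _ hYle (cl m n (Set.range v)) (fun i => cl_mono (Nat.le_succ i))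
  let C := Y ∩ cl m n (Set.range v) i
  obtain ⟨κ, x, y, h1, h2, h3, h4⟩ := h
  have hCx : ∀ z : C, ∃ k, x k = z.1 := by
    intro z
    have : z.1 ∈ Set.range x := by
      rw [h2]; exact cl_mono (hi.trans hD) z.2.2
    exact this
  choose e he using hCx
  have hg : SP (Subtype.val : C → M) (y ∘ e) := by
    have : x ∘ e = Subtype.val := funext he
    rw [← this]; exact h1.comp e
  obtain ⟨F, hF, -⟩ := hYle
  have hfin : Y.Finite := F.finite_toSet.subset hF
  obtain ⟨f, hf, hfC⟩ := amalg hM.1 hM.2.1 hN Y C hfin Set.inter_subset_left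
    (fun z hz hz' => ⟨hz, hst ⟨hz, step_mono Set.inter_subset_right hz'⟩⟩) (y ∘ e) hg
  have hv' : ∀ o, v' o ∈ Y := fun o => cl_mono (Nat.zero_le d) ⟨o, rfl⟩
  refine ⟨f ⟨c, hv' none⟩, mkEqv hm hn hM hN hf Subtype.range_coe ?_⟩
  rintro (_ | j)
  · exact ⟨⟨c, hv' none⟩, rfl, rfl⟩
  · refine ⟨⟨v j, hv' (some j)⟩, rfl, ?_⟩
    have hc : v j ∈ C := ⟨hv' (some j), cl_mono (Nat.zero_le i) ⟨j, rfl⟩⟩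
    obtain ⟨k, hk, hk'⟩ := h4 j
    rw [hfC _ hc]
    change y (e _) = w j
    rw [← hk']
    exact (h1.eq _ _).1 ((he _).trans hk.symm)

theorem term_var {α : Type*} (t : IncLang.Term α) : ∃ i, t = Term.var i := by
  cases t with
  | var i => exact ⟨i, rfl⟩
  | func f _ => exact Empty.elim f

theorem forth' {m n d D k l : ℕ} (hm : 1 ≤ m) (hn : 1 ≤ n)
    (hD : bd m n (Fintype.card (Option (Fin k ⊕ Fin l))) d ≤ D)
    {M N : Type u} [IncLang.Structure M] [IncLang.Structure N]
    {v : Fin k → M} {xs : Fin l → M} {w : Fin k → N} {ys : Fin l → N}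
    (hM : IsECL m n M) (hN : IsECL m n N)
    (h : Eqv m n D (Sum.elim v xs) (Sum.elim w ys)) (c : M) :
    ∃ e : N, Eqv m n d (Sum.elim v (Fin.snoc xs c : Fin (l + 1) → M))
      (Sum.elim w (Fin.snoc ys e : Fin (l + 1) → N)) := by
  obtain ⟨e, he⟩ := forth hm hn hD hM hN h c
  refine ⟨e, ?_⟩
  let s : Fin k ⊕ Fin (l + 1) → Option (Fin k ⊕ Fin l) := Sum.elim (fun i => some (Sum.inl i))
    (Fin.snoc (fun i => some (Sum.inr i)) none : Fin (l + 1) → Option (Fin k ⊕ Fin l))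
  have hs : Function.Surjective s := by
    rintro (_ | i | i)
    · exact ⟨Sum.inr (Fin.last l), by simp [s]⟩
    · exact ⟨Sum.inl i, by simp [s]⟩
    · exact ⟨Sum.inr i.castSucc, by simp [s]⟩
  have := he.reindex s hs
  convert this using 1
  · ext i
    rcases i with i | i
    · simp [s]
    · refine Fin.lastCases ?_ (fun i => ?_) i <;> simp [s]
  · ext i
    rcases i with i | i
    · simp [s]
    · refine Fin.lastCases ?_ (fun i => ?_) i <;> simp [s]

theorem det {m n k l : ℕ} (hm : 1 ≤ m) (hn : 1 ≤ n) (φ : IncLang.BoundedFormula (Fin k) l) :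
    ∃ d0, ∀ d, d0 ≤ d → ∀ (M N : Type u) [IncLang.Structure M] [IncLang.Structure N],
      IsECL m n M → IsECL m n N → ∀ (v : Fin k → M) (xs : Fin l → M) (w : Fin k → N)
        (ys : Fin l → N), Eqv m n d (Sum.elim v xs) (Sum.elim w ys) →
        (φ.Realize v xs ↔ φ.Realize w ys) := by
  induction φ with
  | falsum => exact ⟨0, fun _ _ _ _ _ _ _ _ _ _ _ _ _ => Iff.rfl⟩
  | equal t₁ t₂ =>
    refine ⟨0, fun d _ M N _ _ hM hN v xs w ys h => ?_⟩
    obtain ⟨i, rfl⟩ := term_var t₁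
    obtain ⟨j, rfl⟩ := term_var t₂
    exact h.sp.eq i j
  | rel R ts =>
    refine ⟨0, fun d _ M N _ _ hM hN v xs w ys h => ?_⟩
    choose i hi using fun j => term_var (ts j)
    obtain rfl : ts = fun j => Term.var (i j) := funext hi
    cases R with
    | pt =>
      have := h.sp.pt (i 0)
      have e : ∀ {K : Type u} (z : _ → K), (fun j => z (i j)) = ![z (i 0)] := by
        intro K z; ext j; fin_cases j; rfl
      simp only [BoundedFormula.Realize, Term.realize_var]
      rw [e, e]; exact this
    | lin =>
      have := h.sp.ln (i 0)
      have e : ∀ {K : Type u} (z : _ → K), (fun j => z (i j)) = ![z (i 0)] := by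
        intro K z; ext j; fin_cases j; rfl
      simp only [BoundedFormula.Realize, Term.realize_var]
      rw [e, e]; exact this
    | inc =>
      have := h.sp.inc (i 0) (i 1)
      have e : ∀ {K : Type u} (z : _ → K), (fun j => z (i j)) = ![z (i 0), z (i 1)] := by
        intro K z; ext j; fin_cases j <;> rfl
      simp only [BoundedFormula.Realize, Term.realize_var]
      rw [e, e]; exact this
  | imp f₁ f₂ ih1 ih2 =>
    obtain ⟨d1, h1⟩ := ih1
    obtain ⟨d2, h2⟩ := ih2
    refine ⟨max d1 d2, fun d hd M N _ _ hM hN v xs w ys h => ?_⟩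
    rw [BoundedFormula.realize_imp, BoundedFormula.realize_imp,
      h1 d (le_of_max_le_left hd) M N hM hN v xs w ys h,
      h2 d (le_of_max_le_right hd) M N hM hN v xs w ys h]
  | @all l f ih =>
    obtain ⟨d1, h1⟩ := ih
    refine ⟨bd m n (Fintype.card (Option (Fin k ⊕ Fin l))) d1,
      fun d hd M N _ _ hM hN v xs w ys h => ?_⟩
    rw [BoundedFormula.realize_all, BoundedFormula.realize_all]
    constructor
    · intro H e
      obtain ⟨c, hc⟩ := forth' hm hn hd hN hM h.symm e
      exact (h1 d1 le_rfl M N hM hN _ _ _ _ hc.symm).1 (H c)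
    · intro H c
      obtain ⟨e, he⟩ := forth' hm hn hd hM hN h c
      exact (h1 d1 le_rfl M N hM hN _ _ _ _ he).2 (H e)

/-- The basic existential formula of a pattern. -/
noncomputable def bform (k b : ℕ) (p : Pat (Fin k ⊕ Fin b)) : IncLang.Formula (Fin k) :=
  (diag (fun i : Fin k ⊕ Fin b => i) p).exs

theorem bform_realize {k b : ℕ} {p : Pat (Fin k ⊕ Fin b)} {M : Type*} [IncLang.Structure M]
    {v : Fin k → M} : (bform k b p).Realize v ↔ ∃ xs, pat (Sum.elim v xs) = p := by
  rw [bform, BoundedFormula.realize_exs]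
  exact exists_congr fun xs => diag_realize _ _

theorem bform_basic {m n k b d : ℕ} {M : Type u} [IncLang.Structure M]
    (h1 : IsIncidenceL M) (h2 : KFreeL m n M) (v : Fin k → M) (xs : Fin b → M)
    (hx : Set.range xs = cl m n (Set.range v) d) :
    IsBasicExistential.{u} m n k (bform k b (pat (Sum.elim v xs))) := by
  classical
  have hr : Set.range (Sum.elim v xs) = Set.range xs := by
    rw [Set.Sum.elim_range]
    apply Set.union_eq_self_of_subset_left
    rw [hx]; exact cl_mono (Nat.zero_le d)
  obtain ⟨q, ⟨e⟩⟩ := Finite.exists_equiv_fin (Set.range (Sum.elim v xs))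
  let f : Fin q → M := fun i => (e.symm i).1
  have hf : Function.Injective f := fun i j h => e.symm.injective (Subtype.ext h)
  let w : Fin k ⊕ Fin b → Fin q := fun i => e ⟨Sum.elim v xs i, i, rfl⟩
  have hfw : ∀ i, f (w i) = Sum.elim v xs i := fun i => by simp [f, w]
  have hws : Function.Surjective w := by
    intro a
    obtain ⟨i, hi⟩ := (e.symm a).2
    exact ⟨i, hf ((hfw i).trans hi)⟩
  let _ : IncLang.Structure (Fin q) :=
    mkStr (fun i => ptL (f i)) (fun i => lnL (f i)) (fun i j => incL (f i) (f j))
  refine ⟨b, Fin q, inferInstance, w, ⟨fun i => h1.1 (f i), fun i => h1.2.1 (f i),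
    fun i j => h1.2.2 (f i) (f j)⟩, ?_, hws, ?_, ?_⟩
  · rintro ⟨A, B, hA, hB, hAP, hBL, hAB⟩
    exact h2 ⟨f ∘ A, f ∘ B, hf.comp hA, hf.comp hB, hAP, hBL, hAB⟩
  · rw [Set.eq_univ_iff_forall]
    intro a
    rintro Y ⟨⟨hY1, hY2⟩, hY3⟩
    have hcl : ∀ z ∈ cl m n (Set.range v) d, ∃ a, f a = z := by
      intro z hz
      rw [← hx, ← hr] at hz
      obtain ⟨i, rfl⟩ := hz
      exact ⟨w i, hfw i⟩
    have key : ∀ i ≤ d, ∀ a, f a ∈ cl m n (Set.range v) i → a ∈ Y := by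
      intro i
      induction i with
      | zero =>
        rintro _ a ⟨j, hj⟩
        refine hY3 ⟨j, hf ?_⟩
        rw [← hj]; exact hfw _
      | succ i ih =>
        intro hi
        have ih := ih (by omega)
        have hin : ∀ z ∈ cl m n (Set.range v) i, ∃ a, f a = z := fun z hz =>
          hcl z (cl_mono (by omega) hz)
        rintro a (hz | ⟨A, hA1, hA2, hA3, hA4⟩ | ⟨B, hB1, hB2, hB3, hB4⟩)
        · exact ih a hz
        · choose A' hA' using fun j => hin _ (hA3 j)
          obtain rfl : f ∘ A' = A := funext hA'
          exact hY1 A' a hA1.of_comp hA2 (fun j => ih _ (hA3 j)) hA4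
        · choose B' hB' using fun j => hin _ (hB3 j)
          obtain rfl : f ∘ B' = B := funext hB'
          exact hY2 B' a hB1.of_comp hB2 (fun j => ih _ (hB3 j)) hB4
    apply key d le_rfl
    obtain ⟨i, rfl⟩ := hws a
    rw [hfw, ← hx, ← hr]
    exact ⟨i, rfl⟩
  · intro M' _ v'
    rw [bform_realize]
    refine exists_congr fun xs' => ?_
    rw [← sp_iff_pat]
    have ew : Sum.elim v xs = f ∘ w := funext fun i => (hfw i).symm
    rw [ew]
    constructor
    · intro h
      exact ⟨fun i j => (h.eq i j).trans hf.eq_iff, h.pt, h.ln, h.inc⟩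
    · rintro ⟨g1, g2, g3, g4⟩
      exact ⟨fun i j => (g1 i j).trans hf.eq_iff.symm, g2, g3, g4⟩

end IncQE

/-- For every first-order formula `φ(x₁, …, x_k)` there are finitely many basic
existential formulas `ψ₁, …, ψ_r` such that in every existentially closed `K_{m,n}`-free
incidence structure `M` and for every `k`-tuple `ā` from `M`, `M ⊨ φ(ā)` iff
`M ⊨ ψᵢ(ā)` for some `i ≤ r`. -/
theorem statement_8 (m n : ℕ) (hm : 1 ≤ m) (hn : 1 ≤ n)
    (k : ℕ) (φ : IncLang.Formula (Fin k)) :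
    ∃ (r : ℕ) (ψ : Fin r → IncLang.Formula (Fin k)),
      (∀ i, IsBasicExistential.{u} m n k (ψ i)) ∧
      ∀ (M : Type u) [IncLang.Structure M], IsECL m n M →
        ∀ v : Fin k → M, φ.Realize v ↔ ∃ i, (ψ i).Realize v := by
  classical
  obtain ⟨d, hd⟩ := IncQE.det.{u} hm hn φ
  replace hd := hd d le_rfl
  let B := IncQE.bd m n k d
  let J := Σ b : Fin (B + 1), IncQE.Pat (Fin k ⊕ Fin b)
  let good : J → Prop := fun j => ∃ (M : Type u) (_ : IncLang.Structure M) (v : Fin k → M)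
    (xs : Fin j.1 → M), IsECL m n M ∧ Set.range xs = IncQE.cl m n (Set.range v) d ∧
      IncQE.pat (Sum.elim v xs) = j.2 ∧ φ.Realize v
  obtain ⟨r, ⟨e⟩⟩ := Finite.exists_equiv_fin {j : J // good j}
  refine ⟨r, fun i => IncQE.bform k _ (e.symm i).1.2, ?_, ?_⟩
  · intro i
    obtain ⟨M, _, v, xs, hM, hx, hp, -⟩ := (e.symm i).2
    beta_reduce
    rw [← hp]
    exact IncQE.bform_basic hM.1 hM.2.1 v xs hx
  · intro M _ hM v
    constructor
    · intro hφ
      have hle : IncQE.Le (IncQE.bd m n k d) (IncQE.cl m n (Set.range v) d) :=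
        IncQE.le_cl hm hn hM.1 hM.2.1 (by simpa using IncQE.le_range v) d
      obtain ⟨F, hF, hFc⟩ := hle
      have hfin : (IncQE.cl m n (Set.range v) d).Finite := F.finite_toSet.subset hF
      let G := hfin.toFinset
      have hG : G.card < B + 1 := by
        have : G ⊆ F := by
          intro z hz
          exact hF (hfin.mem_toFinset.1 hz)
        have := Finset.card_le_card this
        omega
      let xs : Fin G.card → M := fun i => (G.equivFin.symm i).1
      have hx : Set.range xs = IncQE.cl m n (Set.range v) d := by
        ext z
        constructor
        · rintro ⟨i, rfl⟩
          exact hfin.mem_toFinset.1 (G.equivFin.symm i).2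
        · intro hz
          exact ⟨G.equivFin ⟨z, hfin.mem_toFinset.2 hz⟩, by simp [xs]⟩
      let j : J := ⟨⟨G.card, hG⟩, IncQE.pat (Sum.elim v xs)⟩
      have hj : good j := ⟨M, inferInstance, v, xs, hM, hx, rfl, hφ⟩
      refine ⟨e ⟨j, hj⟩, ?_⟩
      beta_reduce
      rw [Equiv.symm_apply_apply]
      exact IncQE.bform_realize.2 ⟨xs, rfl⟩
    · rintro ⟨i, hi⟩
      obtain ⟨xs, hxs⟩ := IncQE.bform_realize.1 hi
      obtain ⟨M', _, v', xs', hM', hx', hp', hφ'⟩ := (e.symm i).2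
      rw [← hp', ← IncQE.sp_iff_pat] at hxs
      have hE : IncQE.Eqv m n d (Sum.elim v' (default : Fin 0 → M'))
          (Sum.elim v (default : Fin 0 → M)) := by
        have hrv : Set.range (Sum.elim v' (default : Fin 0 → M')) = Set.range v' := by
          rw [Set.Sum.elim_range]; simp
        refine IncQE.mkEqv hm hn hM' hM (κ := ULift.{u} (Fin k ⊕ Fin (e.symm i).1.1))
          (x := Sum.elim v' xs' ∘ ULift.down) (y := Sum.elim v xs ∘ ULift.down)
          (hxs.symm.comp _) ?_ ?_
        · rw [hrv, ULift.down_surjective.range_comp, Set.Sum.elim_range, hx']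
          exact Set.union_eq_self_of_subset_left (IncQE.cl_mono (Nat.zero_le d))
        · rintro (a | a)
          · exact ⟨⟨Sum.inl a⟩, rfl, rfl⟩
          · exact a.elim0
      exact (hd M' M hM' hM v' _ v _ hE).1 hφ'
end

section
/- There exists a family, indexed by the functions σ : ℕ → {0,1}, of countably infinite projective planes Γ_σ, each generated under I-closure by a 4-element set of points, such that for all distinct σ and τ the incidence structures Γ_σ and Γ_τ are not isomorphic. In particular, there are 2^{ℵ₀} pairwise non-isomorphic countable projective planes each generated by 4 points. -/
universe u v

/-- An incidence structure on the type `M`: "points" and "lines" partition `M`,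
and incidence only holds between a point and a line. -/
structure IncidenceData (M : Type u) where
  pt : M → Prop
  ln : M → Prop
  inc : M → M → Prop
  pt_or_ln : ∀ z, pt z ∨ ln z
  not_pt_and_ln : ∀ z, ¬(pt z ∧ ln z)
  inc_pt_ln : ∀ x y, inc x y → pt x ∧ ln y

/-- `K_{m,n}`-freeness: there are no `m` pairwise distinct points and `n` pairwise
distinct lines with every one of the points incident to every one of the lines. -/
def KFree (m n : ℕ) {M : Type u} (S : IncidenceData M) : Prop :=
  ¬∃ (a : Fin m → M) (b : Fin n → M),
      Function.Injective a ∧ Function.Injective b ∧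
      (∀ i, S.pt (a i)) ∧ (∀ j, S.ln (b j)) ∧ ∀ i j, S.inc (a i) (b j)

/-- Membership in `T^c_{m,n}`: a `K_{m,n}`-free incidence structure in which every `m`
pairwise distinct points are simultaneously incident to exactly `n-1` pairwise distinct
lines, and every `n` pairwise distinct lines are simultaneously incident to exactly
`m-1` pairwise distinct points. -/
def Complete (m n : ℕ) {M : Type u} (S : IncidenceData M) : Prop :=
  KFree m n S ∧
  (∀ a : Fin m → M, Function.Injective a → (∀ i, S.pt (a i)) →
    ∃ b : Fin (n - 1) → M, Function.Injective b ∧ (∀ j, S.ln (b j)) ∧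
      (∀ i j, S.inc (a i) (b j)) ∧ ∀ y, S.ln y → (∀ i, S.inc (a i) y) → ∃ j, y = b j) ∧
  (∀ b : Fin n → M, Function.Injective b → (∀ j, S.ln (b j)) →
    ∃ a : Fin (m - 1) → M, Function.Injective a ∧ (∀ i, S.pt (a i)) ∧
      (∀ i j, S.inc (a i) (b j)) ∧ ∀ x, S.pt x → (∀ j, S.inc x (b j)) → ∃ i, x = a i)

/-- An embedding of incidence structures: an injective map preserving points, lines,
incidence and non-incidence. -/
structure IncEmbedding {M : Type u} {N : Type v} (S : IncidenceData M)
    (T : IncidenceData N) where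
  toFun : M → N
  inj : Function.Injective toFun
  pt_iff : ∀ x, T.pt (toFun x) ↔ S.pt x
  ln_iff : ∀ x, T.ln (toFun x) ↔ S.ln x
  inc_iff : ∀ x y, T.inc (toFun x) (toFun y) ↔ S.inc x y

/-- A subset `Y` is `I`-closed: whenever `m` pairwise distinct points of `Y` are all
incident to an element `y` of `M`, then `y ∈ Y`, and dually for `n` pairwise distinct
lines of `Y`. -/
def IClosedD (m n : ℕ) {M : Type u} (S : IncidenceData M) (Y : Set M) : Prop :=
  (∀ (a : Fin m → M) (y : M), Function.Injective a → (∀ i, S.pt (a i)) →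
    (∀ i, a i ∈ Y) → (∀ i, S.inc (a i) y) → y ∈ Y) ∧
  (∀ (b : Fin n → M) (x : M), Function.Injective b → (∀ j, S.ln (b j)) →
    (∀ j, b j ∈ Y) → (∀ j, S.inc x (b j)) → x ∈ Y)

/-- The `I`-closure of `A` in `M`: the smallest `I`-closed subset containing `A`. -/
def iclD (m n : ℕ) {M : Type u} (S : IncidenceData M) (A : Set M) : Set M :=
  ⋂₀ {Y : Set M | IClosedD m n S Y ∧ A ⊆ Y}

/-- A projective plane: a `K_{2,2}`-free incidence structure in which any two distinct
points are both incident to exactly one common line and any two distinct lines are both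
incident to exactly one common point. -/
def IsProjPlane {M : Type u} (S : IncidenceData M) : Prop :=
  KFree 2 2 S ∧
  (∀ x y, S.pt x → S.pt y → x ≠ y → ∃! z, S.inc x z ∧ S.inc y z) ∧
  (∀ x y, S.ln x → S.ln y → x ≠ y → ∃! z, S.inc z x ∧ S.inc z y)

/-- An isomorphism of incidence structures: a bijection preserving points, lines,
incidence and non-incidence. -/
structure IncIso {M : Type u} {N : Type v} (S : IncidenceData M) (T : IncidenceData N) where
  toEquiv : M ≃ N
  pt_iff : ∀ x, T.pt (toEquiv x) ↔ S.pt x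
  ln_iff : ∀ x, T.ln (toEquiv x) ↔ S.ln x
  inc_iff : ∀ x y, T.inc (toEquiv x) (toEquiv y) ↔ S.inc x y

namespace Moulton

set_option linter.unusedSectionVars false

/-- Points and lines of the (projective) Moulton-type plane over `F`. -/
inductive Pl (F : Type) where
  | pt2 (x y : F) : Pl F
  | ptm (m : F) : Pl F
  | ptinf : Pl F
  | ln2 (m b : F) : Pl F
  | lnv (c : F) : Pl F
  | lninf : Pl F

open Pl

instance {F : Type} [Countable F] [Zero F] : Countable (Pl F) := by
  let f : Pl F → ℕ × F × F := fun z => match z with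
    | pt2 x y => (0, x, y)
    | ptm m => (1, m, m)
    | ptinf => (2, 0, 0)
    | ln2 m b => (3, m, b)
    | lnv c => (4, c, c)
    | lninf => (5, 0, 0)
  have hf : Function.Injective f := by
    intro a b h
    cases a <;> cases b <;> simp_all [f]
  exact hf.countable

section
variable {F : Type} [Field F] [LinearOrder F] [IsStrictOrderedRing F]

/-- Moulton multiplication. -/
def op (k m x : F) : F := if m < 0 ∧ x < 0 then k * m * x else m * x

lemma op_comm (k m x : F) : op k m x = op k x m := by
  unfold op
  by_cases h : m < 0 ∧ x < 0
  · rw [if_pos h, if_pos h.symm]; ring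
  · rw [if_neg h, if_neg (fun h' => h h'.symm)]; ring

@[simp] lemma op_zero (k m : F) : op k m 0 = 0 := by simp [op]
@[simp] lemma zero_op (k m : F) : op k 0 m = 0 := by simp [op]
@[simp] lemma op_one (k m : F) : op k m 1 = m := by
  have : ¬ (1 : F) < 0 := not_lt.2 zero_le_one
  simp [op, this]
@[simp] lemma one_op (k m : F) : op k 1 m = m := by rw [op_comm]; simp

/-- slope on the negative half -/
def cc (k m : F) : F := if m < 0 then k * m else m

lemma cc_lt {k : F} (hk : 0 < k) {m n : F} (h : m < n) : cc k m < cc k n := by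
  unfold cc
  split_ifs with h1 h2 h2
  · exact mul_lt_mul_of_pos_left h hk
  · exact lt_of_lt_of_le (mul_neg_of_pos_of_neg hk h1) (not_lt.1 h2)
  · exact absurd (h.trans h2) h1
  · exact h

lemma op_nonneg (k m : F) {x : F} (hx : 0 ≤ x) : op k m x = m * x := by
  simp [op, not_lt.2 hx]

lemma op_neg (k m : F) {x : F} (hx : x < 0) : op k m x = cc k m * x := by
  unfold op cc
  by_cases h : m < 0 <;> simp [h, hx]

lemma solve_lt {k : F} (hk : 0 < k) {m n : F} (h : n < m) (d : F) :
    ∃! x, op k m x - op k n x = d := by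
  have h1 : 0 < m - n := sub_pos.2 h
  have h2 : 0 < cc k m - cc k n := sub_pos.2 (cc_lt hk h)
  have key : ∀ x, op k m x - op k n x = d ↔
      x = if 0 ≤ d then d / (m - n) else d / (cc k m - cc k n) := by
    intro x
    rcases le_or_gt 0 x with hx | hx
    · rw [op_nonneg k m hx, op_nonneg k n hx, ← sub_mul]
      split_ifs with hd
      · rw [eq_div_iff h1.ne', mul_comm]
      · constructor
        · intro e; exact absurd (e ▸ mul_nonneg h1.le hx) hd
        · intro e
          exact absurd (e ▸ hx) (not_le.2 (div_neg_of_neg_of_pos (not_le.1 hd) h2))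
    · rw [op_neg k m hx, op_neg k n hx, ← sub_mul]
      split_ifs with hd
      · constructor
        · intro e
          exact absurd (mul_neg_of_pos_of_neg h2 hx) (not_lt.2 (e ▸ hd))
        · intro e
          exact absurd (e ▸ hx) (not_lt.2 (div_nonneg hd h1.le))
      · rw [eq_div_iff h2.ne', mul_comm]
  exact ⟨_, (key _).2 rfl, fun y hy => (key y).1 hy⟩

lemma solve {k : F} (hk : 0 < k) {m n : F} (h : m ≠ n) (d : F) :
    ∃! x, op k m x - op k n x = d := by
  rcases lt_or_gt_of_ne h with h | h
  · obtain ⟨x, hx, hu⟩ := solve_lt hk h (-d)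
    refine ⟨x, ?_, fun y hy => hu y ?_⟩
    · simp only at hx ⊢; linear_combination -hx
    · simp only at hy ⊢; linear_combination -hy
  · exact solve_lt hk h d

/-- Points. -/
def isPt : Pl F → Prop
  | pt2 _ _ => True
  | ptm _ => True
  | ptinf => True
  | _ => False

/-- Incidence. -/
def isInc (k : F) : Pl F → Pl F → Prop
  | pt2 x y, ln2 m b => y = op k m x + b
  | pt2 x _, lnv c => x = c
  | ptm m, ln2 m' _ => m = m'
  | ptm _, lninf => True
  | ptinf, lnv _ => True
  | ptinf, lninf => True
  | _, _ => False

/-- The plane. -/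
def plane (k : F) : IncidenceData (Pl F) where
  pt := isPt
  ln z := ¬ isPt z
  inc := isInc k
  pt_or_ln z := em _
  not_pt_and_ln z := fun h => h.2 h.1
  inc_pt_ln x y := by cases x <;> cases y <;> simp [isInc, isPt]

lemma join_unique {k : F} (hk : 0 < k) (x y : Pl F) (hx : isPt x) (hy : isPt y) (hne : x ≠ y) :
    ∃! z, isInc k x z ∧ isInc k y z := by
  cases x with
  | pt2 a b =>
    cases y with
    | pt2 c d =>
      by_cases hac : a = c
      · subst hac
        have hbd : b ≠ d := fun h => hne (by rw [h])
        refine ⟨lnv a, by simp [isInc], ?_⟩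
        rintro (_ | _ | _ | _ | _ | _) <;> simp [isInc]
        · rintro rfl h; exact hbd h.symm
        · rintro rfl; rfl
      · obtain ⟨m, hm, hu⟩ := solve hk hac (b - d)
        simp only [op_comm k a, op_comm k c] at hm hu
        refine ⟨ln2 m (b - op k m a), ⟨by simp [isInc], ?_⟩, ?_⟩
        · simp only [isInc]; linear_combination hm
        · rintro (_ | _ | _ | ⟨n, e⟩ | _ | _) <;> simp [isInc]
          · intro h1 h2
            have : n = m := hu n (by linear_combination h2 - h1)
            subst this
            exact ⟨rfl, by linear_combination -h1⟩
          · rintro rfl; exact fun h => hac h.symm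
    | ptm m =>
      refine ⟨ln2 m (b - op k m a), by simp [isInc], ?_⟩
      rintro (_ | _ | _ | _ | _ | _) <;> simp [isInc]
      rintro h rfl; exact ⟨rfl, by linear_combination -h⟩
    | ptinf =>
      refine ⟨lnv a, by simp [isInc], ?_⟩
      rintro (_ | _ | _ | _ | _ | _) <;> simp [isInc]
      exact fun h => h.symm
    | _ => exact hy.elim
  | ptm m =>
    cases y with
    | pt2 a b =>
      refine ⟨ln2 m (b - op k m a), by simp [isInc], ?_⟩
      rintro (_ | _ | _ | _ | _ | _) <;> simp [isInc]
      rintro rfl h; exact ⟨rfl, by linear_combination -h⟩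
    | ptm n =>
      have hmn : m ≠ n := fun h => hne (by rw [h])
      refine ⟨lninf, by simp [isInc], ?_⟩
      rintro (_ | _ | _ | _ | _ | _) <;> simp [isInc]
      rintro rfl h; exact hmn h.symm
    | ptinf =>
      refine ⟨lninf, by simp [isInc], ?_⟩
      rintro (_ | _ | _ | _ | _ | _) <;> simp [isInc]
    | _ => exact hy.elim
  | ptinf =>
    cases y with
    | pt2 a b =>
      refine ⟨lnv a, by simp [isInc], ?_⟩
      rintro (_ | _ | _ | _ | _ | _) <;> simp [isInc]
      exact fun h => h.symm
    | ptm n =>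
      refine ⟨lninf, by simp [isInc], ?_⟩
      rintro (_ | _ | _ | _ | _ | _) <;> simp [isInc]
    | ptinf => exact absurd rfl hne
    | _ => exact hy.elim
  | _ => exact hx.elim

lemma meet_unique {k : F} (hk : 0 < k) (x y : Pl F) (hx : ¬ isPt x) (hy : ¬ isPt y)
    (hne : x ≠ y) : ∃! z, isInc k z x ∧ isInc k z y := by
  cases x with
  | ln2 m b =>
    cases y with
    | ln2 n d =>
      by_cases hmn : m = n
      · subst hmn
        have hbd : b ≠ d := fun h => hne (by rw [h])
        refine ⟨ptm m, by simp [isInc], ?_⟩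
        rintro (_ | _ | _ | _ | _ | _) <;> simp [isInc]
        rintro rfl h; exact hbd (add_left_cancel h)
      · obtain ⟨x, hm, hu⟩ := solve hk hmn (d - b)
        refine ⟨pt2 x (op k m x + b), ⟨by simp [isInc], ?_⟩, ?_⟩
        · simp only [isInc]; linear_combination hm
        · rintro (⟨u, v⟩ | _ | _ | _ | _ | _) <;> simp [isInc]
          · intro h1 h2
            have : u = x := hu u (by simp only; linear_combination h2 - h1)
            subst this
            exact ⟨rfl, h1⟩
          · rintro rfl; exact fun h => hmn h
    | lnv c =>
      refine ⟨pt2 c (op k m c + b), by simp [isInc], ?_⟩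
      rintro (_ | _ | _ | _ | _ | _) <;> simp [isInc]
      rintro h rfl; exact ⟨rfl, h⟩
    | lninf =>
      refine ⟨ptm m, by simp [isInc], ?_⟩
      rintro (_ | _ | _ | _ | _ | _) <;> simp [isInc]
    | _ => exact (hy trivial).elim
  | lnv c =>
    cases y with
    | ln2 m b =>
      refine ⟨pt2 c (op k m c + b), by simp [isInc], ?_⟩
      rintro (_ | _ | _ | _ | _ | _) <;> simp [isInc]
      rintro rfl h; exact ⟨rfl, h⟩
    | lnv d =>
      have hcd : c ≠ d := fun h => hne (by rw [h])
      refine ⟨ptinf, by simp [isInc], ?_⟩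
      rintro (_ | _ | _ | _ | _ | _) <;> simp [isInc]
      rintro rfl h; exact hcd h
    | lninf =>
      refine ⟨ptinf, by simp [isInc], ?_⟩
      rintro (_ | _ | _ | _ | _ | _) <;> simp [isInc]
    | _ => exact (hy trivial).elim
  | lninf =>
    cases y with
    | ln2 m b =>
      refine ⟨ptm m, by simp [isInc], ?_⟩
      rintro (_ | _ | _ | _ | _ | _) <;> simp [isInc]
    | lnv d =>
      refine ⟨ptinf, by simp [isInc], ?_⟩
      rintro (_ | _ | _ | _ | _ | _) <;> simp [isInc]
    | lninf => exact absurd rfl hne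
    | _ => exact (hy trivial).elim
  | _ => exact (hx trivial).elim

end

lemma isProjPlane_of {M : Type} (S : IncidenceData M)
    (h1 : ∀ x y, S.pt x → S.pt y → x ≠ y → ∃! z, S.inc x z ∧ S.inc y z)
    (h2 : ∀ x y, S.ln x → S.ln y → x ≠ y → ∃! z, S.inc z x ∧ S.inc z y) : IsProjPlane S := by
  refine ⟨?_, h1, h2⟩
  rintro ⟨a, b, ha, hb, hpa, -, hi⟩
  have h := (h1 (a 0) (a 1) (hpa 0) (hpa 1) (ha.ne (by decide))).unique
    ⟨hi 0 0, hi 1 0⟩ ⟨hi 0 1, hi 1 1⟩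
  exact absurd (hb h) (by decide)

/-- Restriction of an incidence structure to a subset. -/
def restr {M : Type} (S : IncidenceData M) (C : Set M) : IncidenceData C where
  pt z := S.pt z
  ln z := S.ln z
  inc x y := S.inc x y
  pt_or_ln z := S.pt_or_ln z
  not_pt_and_ln z := S.not_pt_and_ln z
  inc_pt_ln x y := S.inc_pt_ln x y

lemma closed_iff {M : Type} (S : IncidenceData M) (Y : Set M) :
    IClosedD 2 2 S Y ↔
      (∀ p q y, p ≠ q → p ∈ Y → q ∈ Y → S.inc p y → S.inc q y → y ∈ Y) ∧
      (∀ p q y, p ≠ q → p ∈ Y → q ∈ Y → S.inc y p → S.inc y q → y ∈ Y) := by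
  constructor
  · rintro ⟨h1, h2⟩
    constructor
    · intro p q y hne hp hq hpy hqy
      refine h1 ![p, q] y ?_ ?_ ?_ ?_
      · intro i j; fin_cases i <;> fin_cases j <;> simp [hne, hne.symm]
      · simp [Fin.forall_fin_two, (S.inc_pt_ln _ _ hpy).1, (S.inc_pt_ln _ _ hqy).1]
      · simp [Fin.forall_fin_two, hp, hq]
      · simp [Fin.forall_fin_two, hpy, hqy]
    · intro p q y hne hp hq hpy hqy
      refine h2 ![p, q] y ?_ ?_ ?_ ?_
      · intro i j; fin_cases i <;> fin_cases j <;> simp [hne, hne.symm]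
      · simp [Fin.forall_fin_two, (S.inc_pt_ln _ _ hpy).2, (S.inc_pt_ln _ _ hqy).2]
      · simp [Fin.forall_fin_two, hp, hq]
      · simp [Fin.forall_fin_two, hpy, hqy]
  · rintro ⟨h1, h2⟩
    exact ⟨fun a y ha _ hY hi => h1 (a 0) (a 1) y (ha.ne (by decide)) (hY 0) (hY 1) (hi 0) (hi 1),
      fun a y ha _ hY hi => h2 (a 0) (a 1) y (ha.ne (by decide)) (hY 0) (hY 1) (hi 0) (hi 1)⟩

lemma icl_closed {M : Type} (S : IncidenceData M) (A : Set M) :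
    IClosedD 2 2 S (iclD 2 2 S A) := by
  rw [closed_iff]
  constructor
  · intro p q y hne hp hq hpy hqy Y hY
    exact ((closed_iff S Y).1 hY.1).1 p q y hne (hp Y hY) (hq Y hY) hpy hqy
  · intro p q y hne hp hq hpy hqy Y hY
    exact ((closed_iff S Y).1 hY.1).2 p q y hne (hp Y hY) (hq Y hY) hpy hqy

lemma subset_icl {M : Type} (S : IncidenceData M) (A : Set M) : A ⊆ iclD 2 2 S A :=
  fun _ hx _ hY => hY.2 hx

lemma restr_proj {M : Type} {S : IncidenceData M} (hS : IsProjPlane S) {C : Set M}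
    (hC : IClosedD 2 2 S C) : IsProjPlane (restr S C) := by
  rw [closed_iff] at hC
  apply isProjPlane_of
  · intro x y hx hy hne
    have hne' : (x : M) ≠ y := fun h => hne (Subtype.ext h)
    obtain ⟨z, hz, hu⟩ := hS.2.1 x y hx hy hne'
    exact ⟨⟨z, hC.1 x y z hne' x.2 y.2 hz.1 hz.2⟩, hz, fun w hw => Subtype.ext (hu w hw)⟩
  · intro x y hx hy hne
    have hne' : (x : M) ≠ y := fun h => hne (Subtype.ext h)
    obtain ⟨z, hz, hu⟩ := hS.2.2 x y hx hy hne'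
    exact ⟨⟨z, hC.2 x y z hne' x.2 y.2 hz.1 hz.2⟩, hz, fun w hw => Subtype.ext (hu w hw)⟩

lemma restr_gen {M : Type} (S : IncidenceData M) {ι : Type} (a : ι → M) :
    iclD 2 2 (restr S (iclD 2 2 S (Set.range a)))
      (Set.range fun i => (⟨a i, subset_icl S _ ⟨i, rfl⟩⟩ : iclD 2 2 S (Set.range a))) =
      Set.univ := by
  rw [Set.eq_univ_iff_forall]
  rintro ⟨z, hz⟩ Y ⟨hY, hA⟩
  rw [closed_iff] at hY
  have hc := (closed_iff _ _).1 (icl_closed S (Set.range a))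
  obtain ⟨z', hz', rfl⟩ := hz (Set.image Subtype.val Y) ⟨by
    rw [closed_iff]
    constructor
    · rintro _ _ y hne ⟨p, hp, rfl⟩ ⟨q, hq, rfl⟩ h1 h2
      exact ⟨⟨y, hc.1 p q y hne p.2 q.2 h1 h2⟩,
        hY.1 p q _ (fun h => hne (by rw [h])) hp hq h1 h2, rfl⟩
    · rintro _ _ y hne ⟨p, hp, rfl⟩ ⟨q, hq, rfl⟩ h1 h2
      exact ⟨⟨y, hc.2 p q y hne p.2 q.2 h1 h2⟩,
        hY.2 p q _ (fun h => hne (by rw [h])) hp hq h1 h2, rfl⟩, by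
    rintro _ ⟨i, rfl⟩
    exact ⟨_, hA ⟨i, rfl⟩, rfl⟩⟩
  exact hz'

section
variable {F : Type} [Field F] [LinearOrder F] [IsStrictOrderedRing F]
variable {G : Type} [Field G] [LinearOrder G] [IsStrictOrderedRing G]

/-- The four marked points. -/
def mark (F : Type) [Field F] : Fin 4 → Pl F := ![pt2 0 0, ptm 0, ptinf, pt2 1 1]

/-- The generated subplane. -/
def sub (k : F) : Set (Pl F) := iclD 2 2 (plane k) (Set.range (mark F))

/-- Marks as elements of the subplane. -/
def smark (k : F) (i : Fin 4) : sub k := ⟨mark F i, subset_icl (plane k) _ ⟨i, rfl⟩⟩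

lemma mark_inj : Function.Injective (mark F) := by
  intro i j; fin_cases i <;> fin_cases j <;> simp [mark]

lemma plane_proj {k : F} (hk : 0 < k) : IsProjPlane (plane k) :=
  isProjPlane_of _ (join_unique hk) (meet_unique hk)

/-- The graph of a marked isomorphism, as a relation between the ambient planes. -/
def rel {k : F} {l : G} (φ : IncIso (restr (plane k) (sub k)) (restr (plane l) (sub l)))
    (x : Pl F) (y : Pl G) : Prop := ∃ h : x ∈ sub k, (φ.toEquiv ⟨x, h⟩ : Pl G) = y

variable {k : F} {l : G} (hl : 0 < l)
  (φ : IncIso (restr (plane k) (sub k)) (restr (plane l) (sub l)))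

include hl in
lemma rel_join {p q z : Pl F} {p' q' z' : Pl G} (hp : rel φ p p') (hq : rel φ q q')
    (hne : p ≠ q) (h1 : isInc k p z) (h2 : isInc k q z) (h1' : isInc l p' z')
    (h2' : isInc l q' z') : rel φ z z' := by
  obtain ⟨hp, rfl⟩ := hp
  obtain ⟨hq, rfl⟩ := hq
  have hz : z ∈ sub k :=
    ((closed_iff _ _).1 (icl_closed (plane k) (Set.range (mark F)))).1 p q z hne hp hq h1 h2
  refine ⟨hz, ?_⟩
  refine (join_unique hl _ _ ((plane l).inc_pt_ln _ _ h1').1 ((plane l).inc_pt_ln _ _ h2').1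
    ?_).unique ⟨?_, ?_⟩ ⟨h1', h2'⟩
  · intro h
    have := φ.toEquiv.injective (Subtype.ext h)
    exact hne (congrArg Subtype.val this)
  · exact (φ.inc_iff ⟨p, hp⟩ ⟨z, hz⟩).2 h1
  · exact (φ.inc_iff ⟨q, hq⟩ ⟨z, hz⟩).2 h2

include hl in
lemma rel_meet {p q z : Pl F} {p' q' z' : Pl G} (hp : rel φ p p') (hq : rel φ q q')
    (hne : p ≠ q) (h1 : isInc k z p) (h2 : isInc k z q) (h1' : isInc l z' p')
    (h2' : isInc l z' q') : rel φ z z' := by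
  obtain ⟨hp, rfl⟩ := hp
  obtain ⟨hq, rfl⟩ := hq
  have hz : z ∈ sub k :=
    ((closed_iff _ _).1 (icl_closed (plane k) (Set.range (mark F)))).2 p q z hne hp hq h1 h2
  refine ⟨hz, ?_⟩
  refine (meet_unique hl _ _ ((plane l).inc_pt_ln _ _ h1').2 ((plane l).inc_pt_ln _ _ h2').2
    ?_).unique ⟨?_, ?_⟩ ⟨h1', h2'⟩
  · intro h
    have := φ.toEquiv.injective (Subtype.ext h)
    exact hne (congrArg Subtype.val this)
  · exact (φ.inc_iff ⟨z, hz⟩ ⟨p, hp⟩).2 h1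
  · exact (φ.inc_iff ⟨z, hz⟩ ⟨q, hq⟩).2 h2

lemma rel_inj {p q : Pl F} {p' q' : Pl G} (hp : rel φ p p') (hq : rel φ q q') :
    p = q ↔ p' = q' := by
  obtain ⟨hp, rfl⟩ := hp
  obtain ⟨hq, rfl⟩ := hq
  rw [← Subtype.ext_iff, φ.toEquiv.injective.eq_iff, Subtype.mk.injEq]

variable (hm : ∀ i, φ.toEquiv (smark k i) = smark l i)

include hm in
lemma rel_mark (i : Fin 4) : rel φ (mark F i) (mark G i) :=
  ⟨(smark k i).2, congrArg Subtype.val (hm i)⟩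

/-- Related scalars. -/
def E (a : F) (b : G) : Prop := rel φ (pt2 a a) (pt2 b b)

include hm in
lemma rO : rel φ (pt2 0 0) (pt2 0 0) := rel_mark φ hm 0
include hm in
lemma rX : rel φ (ptm 0) (ptm 0) := rel_mark φ hm 1
include hm in
lemma rY : rel φ ptinf ptinf := rel_mark φ hm 2
include hm in
lemma rU : rel φ (pt2 1 1) (pt2 1 1) := rel_mark φ hm 3

include hl hm

lemma rInf : rel φ lninf lninf :=
  rel_join hl φ (rX φ hm) (rY φ hm) (by simp) trivial trivial trivial trivial

lemma rDiag : rel φ (ln2 1 0) (ln2 1 0) :=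
  rel_join hl φ (rO φ hm) (rU φ hm) (by simp) (by simp [isInc]) (by simp [isInc])
    (by simp [isInc]) (by simp [isInc])

lemma rM1 : rel φ (ptm 1) (ptm 1) :=
  rel_meet hl φ (rDiag hl φ hm) (rInf hl φ hm) (by simp) (by simp [isInc]) (by simp [isInc])
    (by simp [isInc]) (by simp [isInc])

lemma E_ver {a : F} {b : G} (h : E φ a b) : rel φ (lnv a) (lnv b) :=
  rel_join hl φ h (rY φ hm) (by simp) (by simp [isInc]) (by simp [isInc])
    (by simp [isInc]) (by simp [isInc])

lemma E_hor {a : F} {b : G} (h : E φ a b) : rel φ (ln2 0 a) (ln2 0 b) :=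
  rel_join hl φ h (rX φ hm) (by simp) (by simp [isInc]) (by simp [isInc])
    (by simp [isInc]) (by simp [isInc])

lemma E_pt {a c : F} {b d : G} (h : E φ a b) (h' : E φ c d) : rel φ (pt2 a c) (pt2 b d) :=
  rel_meet hl φ (E_ver hl φ hm h) (E_hor hl φ hm h') (by simp) (by simp [isInc]) (by simp [isInc])
    (by simp [isInc]) (by simp [isInc])

lemma E_of_pt {a c : F} {b d : G} (h : rel φ (pt2 a c) (pt2 b d)) : E φ c d :=
  rel_meet hl φ (rDiag hl φ hm)
    (rel_join hl φ (z := ln2 0 c) (z' := ln2 0 d) h (rX φ hm) (by simp) (by simp [isInc])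
      (by simp [isInc]) (by simp [isInc]) (by simp [isInc]))
    (by simp) (by simp [isInc]) (by simp [isInc]) (by simp [isInc]) (by simp [isInc])

lemma E_neg {a : F} {b : G} (h : E φ a b) : E φ (-a) (-b) := by
  have h1 : rel φ (ln2 1 (-a)) (ln2 1 (-b)) :=
    rel_join hl φ (E_pt hl φ hm h (rO φ hm)) (rM1 hl φ hm) (by simp) (by simp [isInc])
      (by simp [isInc]) (by simp [isInc]) (by simp [isInc])
  exact E_of_pt hl φ hm (a := 0) (b := 0)
    (rel_meet hl φ h1 (E_ver hl φ hm (rO φ hm)) (by simp) (by simp [isInc])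
      (by simp [isInc]) (by simp [isInc]) (by simp [isInc]))

lemma E_add {a c : F} {b d : G} (h : E φ a b) (h' : E φ c d) : E φ (a + c) (b + d) := by
  have h1 : rel φ (ln2 1 c) (ln2 1 d) :=
    rel_join hl φ (E_pt hl φ hm (rO φ hm) h') (rM1 hl φ hm) (by simp) (by simp [isInc])
      (by simp [isInc]) (by simp [isInc]) (by simp [isInc])
  exact E_of_pt hl φ hm (a := a) (b := b)
    (rel_meet hl φ h1 (E_ver hl φ hm h) (by simp) (by simp [isInc])
      (by simp [isInc]) (by simp [isInc]) (by simp [isInc]))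

lemma E_op {a c : F} {b d : G} (h : E φ a b) (h' : E φ c d) :
    E φ (op k a c) (op l b d) := by
  have h1 : rel φ (ln2 a 0) (ln2 b 0) :=
    rel_join hl φ (rO φ hm) (E_pt hl φ hm (rU φ hm) h) (by simp) (by simp [isInc])
      (by simp [isInc]) (by simp [isInc]) (by simp [isInc])
  exact E_of_pt hl φ hm (a := c) (b := d)
    (rel_meet hl φ h1 (E_ver hl φ hm h') (by simp) (by simp [isInc])
      (by simp [isInc]) (by simp [isInc]) (by simp [isInc]))

/-- Related pairs form a subgroup. -/
def Egrp : AddSubgroup (F × G) where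
  carrier := {x | E φ x.1 x.2}
  zero_mem' := rO φ hm
  add_mem' h h' := E_add hl φ hm h h'
  neg_mem' h := E_neg hl φ hm h

lemma E_one_neg : E φ (-1) (-1) := E_neg hl φ hm (rU φ hm)

lemma E_k : E φ k l := by
  have := E_op hl φ hm (E_one_neg hl φ hm) (E_one_neg hl φ hm)
  simpa [op] using this

lemma E_lin (p q : ℤ) : E φ (q * k - p) (q * l - p) := by
  have : q • ((k, l) : F × G) - p • ((1, 1) : F × G) ∈ Egrp hl φ hm :=
    sub_mem (zsmul_mem (E_k hl φ hm) q) (zsmul_mem (rU φ hm) p)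
  have h : E φ _ _ := this
  simpa using h

lemma E_sign (hk1 : k ≠ 1) (hl1 : l ≠ 1) {a : F} {b : G} (h : E φ a b) : a < 0 ↔ b < 0 := by
  have h1 := E_add hl φ hm h (E_op hl φ hm (E_one_neg hl φ hm) h)
  have h2 := rel_inj φ h1 (rO φ hm)
  have aux : ∀ {H : Type} [Field H] [LinearOrder H] [IsStrictOrderedRing H] (t : H) (x : H),
      t ≠ 1 → ((pt2 (x + op t (-1) x) (x + op t (-1) x) : Pl H) = pt2 0 0 ↔ ¬ x < 0) := by
    intro H _ _ _ t x ht
    by_cases hx : x < 0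
    · have : x + op t (-1) x = x * (1 - t) := by simp [op, hx]; ring
      simp [this, hx, hx.ne, sub_eq_zero, ht.symm]
    · simp [op, hx]
  rw [aux k a hk1, aux l b hl1] at h2
  exact not_iff_not.1 h2

end

/-- Index type. -/
abbrev K := {k : ℝ // 1 < k}

/-- The coordinate field. -/
noncomputable abbrev Fd (k : K) : Subfield ℝ := Subfield.closure {(k : ℝ)}

instance (k : K) : Countable (Fd k) := by
  rw [← Cardinal.mk_le_aleph0_iff]
  refine (Subfield.cardinalMk_closure_le_max _).trans (max_le ?_ le_rfl)
  exact Cardinal.mk_le_aleph0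

/-- The parameter in its field. -/
noncomputable def par (k : K) : Fd k := ⟨k.1, Subfield.subset_closure rfl⟩

lemma par_pos (k : K) : 0 < par k := by
  have : (0 : ℝ) < k.1 := by linarith [k.2]
  exact this

lemma par_ne (k : K) : par k ≠ 1 := by
  intro h
  have : k.1 = 1 := congrArg Subtype.val h
  exact k.2.ne' this

/-- The plane with parameter `k`. -/
abbrev Q (k : K) : Type := sub (par k)

/-- Its incidence data. -/
noncomputable abbrev QS (k : K) : IncidenceData (Q k) := restr (plane (par k)) (sub (par k))

lemma not_lt_of_marked (k l : K) (φ : IncIso (QS k) (QS l))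
    (hm : ∀ i, φ.toEquiv (smark (par k) i) = smark (par l) i) : ¬ k.1 < l.1 := by
  intro h
  obtain ⟨r, h1, h2⟩ := exists_rat_btwn h
  have hE := E_lin (par_pos l) φ hm r.num r.den
  have hs := E_sign (par_pos l) φ hm (par_ne k) (par_ne l) hE
  have hd : (0 : ℝ) < r.den := by exact_mod_cast r.den_pos
  have hr : (r : ℝ) * r.den = r.num := by exact_mod_cast Rat.mul_den_eq_num r
  have a1 : (r.den : ℝ) * k.1 - r.num < 0 := by rw [← hr]; nlinarith
  have a2 : ¬ (r.den : ℝ) * l.1 - r.num < 0 := by rw [← hr]; nlinarith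
  have b1 : ((r.den : ℤ) : Fd k) * par k - (r.num : Fd k) < 0 := by
    rw [← Subtype.coe_lt_coe]; push_cast; exact a1
  have b2 := hs.1 b1
  rw [← Subtype.coe_lt_coe] at b2; push_cast at b2; exact a2 b2

/-- Inverse. -/
def isymm {M N : Type} {S : IncidenceData M} {T : IncidenceData N} (f : IncIso S T) :
    IncIso T S where
  toEquiv := f.toEquiv.symm
  pt_iff x := by rw [← f.pt_iff, Equiv.apply_symm_apply]
  ln_iff x := by rw [← f.ln_iff, Equiv.apply_symm_apply]
  inc_iff x y := by rw [← f.inc_iff, Equiv.apply_symm_apply, Equiv.apply_symm_apply]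

/-- Composition. -/
def itrans {M N P : Type} {S : IncidenceData M} {T : IncidenceData N} {U : IncidenceData P}
    (f : IncIso S T) (g : IncIso T U) : IncIso S U where
  toEquiv := f.toEquiv.trans g.toEquiv
  pt_iff x := by simp [g.pt_iff, f.pt_iff]
  ln_iff x := by simp [g.ln_iff, f.ln_iff]
  inc_iff x y := by simp [g.inc_iff, f.inc_iff]

/-- Identity. -/
def irefl {M : Type} (S : IncidenceData M) : IncIso S S where
  toEquiv := Equiv.refl M
  pt_iff _ := Iff.rfl
  ln_iff _ := Iff.rfl
  inc_iff _ _ := Iff.rfl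

lemma marked_eq (k l : K) (φ : IncIso (QS k) (QS l))
    (hm : ∀ i, φ.toEquiv (smark (par k) i) = smark (par l) i) : k = l := by
  apply Subtype.ext
  refine le_antisymm (not_lt.1 (not_lt_of_marked l k (isymm φ) fun i => ?_))
    (not_lt.1 (not_lt_of_marked k l φ hm))
  rw [← hm i]; exact φ.toEquiv.symm_apply_apply _

instance (k : K) : Infinite (Q k) := by
  have h : ∀ n : ℤ, pt2 (n : Fd k) n ∈ sub (par k) := by
    intro n
    have := E_lin (par_pos k) (irefl (QS k)) (fun _ => rfl) (-n) 0
    obtain ⟨h, -⟩ := this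
    simpa using h
  refine Infinite.of_injective (fun n : ℤ => (⟨_, h n⟩ : Q k)) ?_
  intro a b hab
  simpa using hab

/-- Isomorphism as a setoid. -/
def isoSetoid : Setoid K where
  r k l := Nonempty (IncIso (QS k) (QS l))
  iseqv := ⟨fun k => ⟨irefl _⟩, fun ⟨f⟩ => ⟨isymm f⟩, fun ⟨f⟩ ⟨g⟩ => ⟨itrans f g⟩⟩

lemma fiber_countable (l : K) : Countable {k : K // Nonempty (IncIso (QS k) (QS l))} := by
  let f : {k : K // Nonempty (IncIso (QS k) (QS l))} → (Fin 4 → Q l) :=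
    fun k i => k.2.some.toEquiv (smark (par k.1) i)
  have hf : Function.Injective f := by
    intro a b hab
    apply Subtype.ext
    apply marked_eq _ _ (itrans a.2.some (isymm b.2.some))
    intro i
    have : f a i = f b i := congrFun hab i
    change b.2.some.toEquiv.symm (a.2.some.toEquiv _) = _
    rw [Equiv.symm_apply_eq]
    exact this
  exact hf.countable

open Cardinal in
lemma mk_quot : #(ℕ → Bool) ≤ #(Quotient isoSetoid) := by
  have hK : #K = continuum := Cardinal.mk_Ioi_real 1
  have hB : #(ℕ → Bool) = continuum := by simp
  rw [hB]
  by_contra hlt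
  rw [not_le] at hlt
  have h1 : #K = Cardinal.sum fun q : Quotient isoSetoid =>
      #{k : K // Quotient.mk isoSetoid k = q} := by
    rw [← Cardinal.mk_sigma]
    exact Cardinal.mk_congr (Equiv.sigmaFiberEquiv _).symm
  have h2 : #K ≤ #(Quotient isoSetoid) * ℵ₀ := by
    rw [h1, ← Cardinal.sum_const']
    apply Cardinal.sum_le_sum
    intro q
    rw [Cardinal.mk_le_aleph0_iff]
    induction q using Quotient.inductionOn with
    | h l =>
      have := fiber_countable l
      let f : {k : K // Quotient.mk isoSetoid k = Quotient.mk isoSetoid l} →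
        {k : K // Nonempty (IncIso (QS k) (QS l))} := fun k => ⟨k.1, Quotient.exact k.2⟩
      have hf : Function.Injective f := fun a b h => Subtype.ext (congrArg (·.1) h)
      exact hf.countable
  rw [hK] at h2
  have h3 := Cardinal.mul_lt_of_lt Cardinal.aleph0_le_continuum hlt Cardinal.aleph0_lt_continuum
  exact absurd h2 (not_le.2 h3)

end Moulton

/-- There is a family, indexed by functions `σ : ℕ → Bool`, of countably infinite
projective planes, each generated under `I`-closure by a 4-element set of points,
which are pairwise non-isomorphic.  (In particular there are `2^ℵ₀` pairwise
non-isomorphic countable projective planes each generated by 4 points.) -/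
theorem statement_9 :
    ∃ (Γ : (ℕ → Bool) → Type) (S : ∀ σ, IncidenceData (Γ σ)),
      (∀ σ, Countable (Γ σ)) ∧ (∀ σ, Infinite (Γ σ)) ∧
      (∀ σ, IsProjPlane (S σ)) ∧
      (∀ σ, ∃ a : Fin 4 → Γ σ, Function.Injective a ∧ (∀ i, (S σ).pt (a i)) ∧
        iclD 2 2 (S σ) (Set.range a) = Set.univ) ∧
      ∀ σ τ, σ ≠ τ → IsEmpty (IncIso (S σ) (S τ)) := by
  obtain ⟨e⟩ := Moulton.mk_quot
  refine ⟨fun σ => Moulton.Q (e σ).out, fun σ => Moulton.QS (e σ).out,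
    fun σ => inferInstance, fun σ => inferInstance,
    fun σ => Moulton.restr_proj (Moulton.plane_proj (Moulton.par_pos _))
      (Moulton.icl_closed _ _), fun σ => ⟨Moulton.smark _, ?_, ?_, ?_⟩, ?_⟩
  · intro i j h
    exact Moulton.mark_inj (congrArg Subtype.val h)
  · intro i
    fin_cases i <;> exact trivial
  · exact Moulton.restr_gen _ _
  · intro σ τ hne
    refine ⟨fun φ => hne (e.injective ?_)⟩
    rw [← Quotient.out_eq (e σ), ← Quotient.out_eq (e τ)]
    exact Quotient.sound ⟨φ⟩
end
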